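/- arXiv:0710.0152 — 3 statements merged into one kernel-verified Lean document; each statement's English description precedes it below -/
import Mathlib

section
/- There is a family (R_α)_{α∈2^ω} of partial orders on the Polish space 2^ω × 2 such that each R_α belongs to D₂(Σ⁰₁), each R_α is not pot(Π⁰₁) and is ≤_B-minimal among non-pot(Π⁰₁) Borel sets, and the family is a ≤_B-antichain: for α ≠ α' in 2^ω, neither R_α ≤_B R_{α'} nor R_{α'} ≤_B R_α. -/
open Set Topology

abbrev Cantor : Type := ℕ → Bool

/-- `A ⊆ X × Y` is potentially closed (`pot(Π⁰₁)`): there are finer Polish topologies on `X`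
and `Y` making `A` closed in the product. -/
def PotClosed {X Y : Type} (tX : TopologicalSpace X) (tY : TopologicalSpace Y)
    (A : Set (X × Y)) : Prop :=
  ∃ (σ : TopologicalSpace X) (τ : TopologicalSpace Y),
    σ ≤ tX ∧ τ ≤ tY ∧ @PolishSpace X σ ∧ @PolishSpace Y τ ∧
    @IsClosed (X × Y) (@instTopologicalSpaceProd X Y σ τ) A

/-- Membership in the class `D₂(Σ⁰₁)`: difference of two open sets. -/
def D2Sigma01 {Z : Type} (t : TopologicalSpace Z) (A : Set Z) : Prop :=
  ∃ U V : Set Z, @IsOpen Z t U ∧ @IsOpen Z t V ∧ A = U \ V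

/-- The rectangular continuous reducibility `A ≤ʳ_c A'`. -/
def RedRC {X Y X' Y' : Type} (tX : TopologicalSpace X) (tY : TopologicalSpace Y)
    (tX' : TopologicalSpace X') (tY' : TopologicalSpace Y')
    (A : Set (X × Y)) (A' : Set (X' × Y')) : Prop :=
  ∃ (u : X → X') (v : Y → Y'),
    @Continuous X X' tX tX' u ∧ @Continuous Y Y' tY tY' v ∧
    A = (fun p => (u p.1, v p.2)) ⁻¹' A'

/-- `≤ʳ_c` on subsets of `Cantor × Cantor` with the standard topology. -/
def RedC2 (A A' : Set (Cantor × Cantor)) : Prop :=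
  RedRC inferInstance inferInstance inferInstance inferInstance A A'

/-- `A` is `≤ʳ_c`-minimal among non-potentially closed Borel sets. -/
def MinNonPotClosed {X Y : Type} (tX : TopologicalSpace X) (tY : TopologicalSpace Y)
    (A : Set (X × Y)) : Prop :=
  ¬ PotClosed tX tY A ∧
  ∀ (X' Y' : Type) (tX' : TopologicalSpace X') (tY' : TopologicalSpace Y'),
    @PolishSpace X' tX' → @PolishSpace Y' tY' →
    ∀ A' : Set (X' × Y'),
      @MeasurableSet (X' × Y') (@borel (X' × Y') (@instTopologicalSpaceProd X' Y' tX' tY')) A' →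
      ¬ PotClosed tX' tY' A' →
      RedRC tX' tY' tX tY A' A → RedRC tX tY tX' tY' A A'

/-- The Borel reducibility `A ≤_B A'` for square sets. -/
def RedB {Z Z' : Type} (tZ : TopologicalSpace Z) (tZ' : TopologicalSpace Z')
    (A : Set (Z × Z)) (A' : Set (Z' × Z'))  : Prop :=
  ∃ u : Z → Z', @Measurable Z Z' (@borel Z tZ) (@borel Z' tZ') u ∧
    A = (fun p => (u p.1, u p.2)) ⁻¹' A'

/-- `A` is `≤_B`-minimal among non-potentially closed Borel (square) sets. -/
def MinBNonPotClosed {Z : Type} (tZ : TopologicalSpace Z) (A : Set (Z × Z)) : Prop :=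
  ¬ PotClosed tZ tZ A ∧
  ∀ (Z' : Type) (tZ' : TopologicalSpace Z'), @PolishSpace Z' tZ' →
    ∀ A' : Set (Z' × Z'),
      @MeasurableSet (Z' × Z') (@borel (Z' × Z') (@instTopologicalSpaceProd Z' Z' tZ' tZ')) A' →
      ¬ PotClosed tZ' tZ' A' →
      RedB tZ' tZ A' A → RedB tZ tZ' A A'

/-- The graph of the partial function `f` with domain `D`. -/
def graphRel {X : Type} (D : Set X) (f : X → X) : Set (X × X) :=
  {p | p.1 ∈ D ∧ p.2 = f p.1}

/-- `A^f := ⋃ₙ Graph(fₙ)`. -/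
def unionGraphs {X : Type} (D : ℕ → Set X) (f : ℕ → X → X) : Set (X × X) :=
  ⋃ n, graphRel (D n) (f n)

/-- `f` restricted to `D` is a partial homeomorphism with clopen domain and clopen range. -/
def IsPartialHomeo {X : Type} (t : TopologicalSpace X) (D : Set X) (f : X → X) : Prop :=
  @IsClopen X t D ∧ @IsClopen X t (f '' D) ∧ @ContinuousOn X X t t f D ∧
    ∃ g : X → X, @ContinuousOn X X t t g (f '' D) ∧ ∀ x ∈ D, g (f x) = x

/-- A converging situation: a nonempty zero-dimensional perfect Polish space together with
partial homeomorphisms with clopen domains and ranges such that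
`Δ(X) = closure(A^f) \ A^f`. -/
def ConvSit (X : Type) (t : TopologicalSpace X) (D : ℕ → Set X) (f : ℕ → X → X) : Prop :=
  Nonempty X ∧ @PolishSpace X t ∧
  @TopologicalSpace.IsTopologicalBasis X t {s : Set X | @IsClopen X t s} ∧
  @Perfect X t Set.univ ∧
  (∀ n, IsPartialHomeo t (D n) (f n)) ∧
  Set.diagonal X =
    @closure (X × X) (@instTopologicalSpaceProd X X t t) (unionGraphs D f) \ unionGraphs D f

/-- The domain of the restriction `f^B` of the partial map `(D, f)` to a subset `B`. -/
def subD {X : Type} (B : Set X) (D : Set X) (f : X → X) : Set ↥B :=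
  {x | (x : X) ∈ D ∧ f (x : X) ∈ B}

/-- The restriction `f^B` of `f` to `B`, as a map of the subtype (junk value outside). -/
noncomputable def subF {X : Type} (B : Set X) (f : X → X) : ↥B → ↥B :=
  fun x =>
    letI := Classical.dec (f (x : X) ∈ B)
    if h : f (x : X) ∈ B then ⟨f (x : X), h⟩ else x

/-- `A^f ∩ B²`, viewed on the subtype `B`: the union of the graphs of the `f^B_n`'s. -/
def restrGraphs {X : Type} (B : Set X) (D : ℕ → Set X) (f : ℕ → X → X) : Set (↥B × ↥B) :=
  unionGraphs (fun n => subD B (D n) (f n)) (fun n => subF B (f n))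

/-- The subspace topology on `B` induced by a topology `t` on `X`. -/
def subTop {X : Type} (t : TopologicalSpace X) (B : Set X) : TopologicalSpace ↥B :=
  @TopologicalSpace.induced ↥B X Subtype.val t

/-- The natural bijection `ψ : ω → 2^{<ω}` (enumeration by length, then lexicographically):
`ψ(n)` is the binary expansion of `n+1` with its leading one removed. -/
def psiSeq (n : ℕ) : List Bool := ((n + 1).bits.dropLast).reverse

/-- `s_n := ψ(n)0^{n-|ψ(n)|}`, a dense sequence with `|s_n| = n`. -/
def sSeq (n : ℕ) : List Bool := psiSeq n ++ List.replicate (n - (psiSeq n).length) false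

/-- The concatenation `sγ` of a finite sequence `s` with `γ ∈ 2^ω`. -/
def catSeq (s : List Bool) (γ : Cantor) : Cantor :=
  fun i => if h : i < s.length then s.get ⟨i, h⟩ else γ (i - s.length)

/-- `A₁ := {(s_n0γ, s_n1γ) : n ∈ ω, γ ∈ 2^ω}`. -/
def A1 : Set (Cantor × Cantor) :=
  {p | ∃ (n : ℕ) (γ : Cantor),
    p.1 = catSeq (sSeq n ++ [false]) γ ∧ p.2 = catSeq (sSeq n ++ [true]) γ}

/-- `Card(x↾n)`: the number of ones among the first `n` coordinates of `x`. -/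
def cardOnes (x : Cantor) (n : ℕ) : ℕ := ∑ i ∈ Finset.range n, (if x i then 1 else 0)

/-- The domain of `f^S_n`: sequences vanishing at `n` whose first `n` coordinates contain a
number of ones belonging to `S`. -/
def DSdom (S : Set ℕ) (n : ℕ) : Set Cantor := {x | x n = false ∧ cardOnes x n ∈ S}

/-- `f^S_n (s0γ) := s1γ`: flip the `n`-th coordinate to one. -/
def fSfun (n : ℕ) : Cantor → Cantor := fun x => Function.update x n true

/-- `A^S := {(s0γ, s1γ) : s ∈ 2^{<ω}, Card(s) ∈ S, γ ∈ 2^ω} = ⋃ₙ Graph(f^S_n)`. -/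
def ASet (S : Set ℕ) : Set (Cantor × Cantor) := unionGraphs (DSdom S) fSfun

/-- Condition (M) on `S ⊆ ω`. -/
def CondM (S : Set ℕ) : Prop :=
  ∀ p : ℕ, ∃ k : ℕ, ∀ q : ℕ, ∃ c : ℕ, q ≤ c ∧ c ≤ q + k ∧
    (fun m => c + m) '' (S ∩ Set.Iic p) = S ∩ Set.Icc c (c + p)

/-- Condition (H) on `S ⊆ ω`. -/
def CondH (S : Set ℕ) : Prop :=
  ∀ C : Set Cantor, @MeasurableSet Cantor (borel Cantor) C →
    ∀ σ : TopologicalSpace ↥C, σ ≤ subTop inferInstance C →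
      ConvSit ↥C σ (fun n => subD C (DSdom S n) (fSfun n)) (fun n => subF C (fSfun n)) →
      ∀ l p : ℕ, ∃ n : ℕ, l ≤ n ∧ ∃ γ : ↥C, γ ∈ subD C (DSdom S n) (fSfun n) ∧
        (fun m => cardOnes (γ : Cantor) n + m) '' (S ∩ Set.Iic p) =
          S ∩ Set.Icc (cardOnes (γ : Cantor) n) (cardOnes (γ : Cantor) n + p)

/-- Condition (⊥) on a pair `(S, S')`. -/
def CondPerp (S S' : Set ℕ) : Prop :=
  ∃ p : ℕ, ∀ c : ℕ, (fun m => c + m) '' (S ∩ Set.Iic p) ≠ S' ∩ Set.Icc c (c + p)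

/-- Condition (⊥⁻¹) on a pair `(S, S')` (stated in `ℤ` to handle subtraction). -/
def CondPerpInv (S S' : Set ℕ) : Prop :=
  ∃ p : ℕ, ∀ c : ℕ,
    (fun m : ℕ => (c : ℤ) - (m : ℤ)) '' (S ∩ Set.Iic p) ≠
      ((fun n : ℕ => (n : ℤ)) '' S') ∩ Set.Icc ((c : ℤ) - (p : ℤ)) (c : ℤ)

/-- `A⁻¹ := {(y,x) : (x,y) ∈ A}`. -/
def invRel {X : Type} (A : Set (X × X)) : Set (X × X) := {p | (p.2, p.1) ∈ A}

/-- `γ_α`: `γ_α(4n+2ε) = ε` and `γ_α(2n+1) = α(n)`. -/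
def gammaSeq (α : Cantor) (k : ℕ) : Bool :=
  if k % 2 = 1 then α (k / 2) else decide (k % 4 = 2)

/-- `β_α(i) := γ_α((i)₀)` where `(i)₀ = max {m : 2^m ∣ i+1}`, with values in `{0,1} ⊆ ω`. -/
def betaSeq (α : Cantor) (i : ℕ) : ℕ :=
  if gammaSeq α ((i + 1).factorization 2) then 1 else 0

/-- `S_β := {Σ_{i<l} (1 + β(i)) : l ∈ ω}`. -/
def Sbeta (β : ℕ → ℕ) : Set ℕ :=
  {m | ∃ l : ℕ, m = ∑ i ∈ Finset.range l, (1 + β i)}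

/-- `s_n` as a function `ℕ → Bool` (with junk value `false` beyond `n`). -/
def sSeqFn (n : ℕ) (i : ℕ) : Bool := (sSeq n).getD i false

/-- The domain of `f¹_n` (direction `d = true`) or of `(f¹_n)⁻¹` (direction `d = false`):
`x` extends `s_n` and `x(n) = !d`. -/
def step1Dom (n : ℕ) (d : Bool) : Set Cantor :=
  {x | (∀ i, i < n → x i = sSeqFn n i) ∧ x n = !d}

/-- `f¹_n` (if `d = true`) or its inverse (if `d = false`): set the `n`-th coordinate to `d`. -/
def step1Fun (n : ℕ) (d : Bool) : Cantor → Cantor := fun x => Function.update x n d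

/-- Domain of `fₙ` (direction `d = true`) or of `fₙ⁻¹` (direction `d = false`). -/
def stepDom {X : Type} (D : ℕ → Set X) (f : ℕ → X → X) (n : ℕ) (d : Bool) : Set X :=
  if d then D n else f n '' D n

/-- `fₙ` (direction `d = true`) or its inverse `gₙ` (direction `d = false`). -/
def stepFun {X : Type} (f g : ℕ → X → X) (n : ℕ) (d : Bool) : X → X :=
  if d then f n else g n

/-- An acyclic situation (Definition 26), with `g n` the inverse of `f n`. -/
def AcyclicSit (X : Type) (t : TopologicalSpace X) (D : ℕ → Set X) (f g : ℕ → X → X) : Prop :=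
  Nonempty X ∧ @PolishSpace X t ∧
  @TopologicalSpace.IsTopologicalBasis X t {s : Set X | @IsClopen X t s} ∧
  @Perfect X t Set.univ ∧
  (∀ n, IsPartialHomeo t (D n) (f n)) ∧
  (∀ n, ∀ x ∈ D n, g n (f n x) = x) ∧
  Set.diagonal X ⊆
    @closure (X × X) (@instTopologicalSpaceProd X X t t) (unionGraphs D f) \ unionGraphs D f ∧
  (∀ m : ℕ, 1 ≤ m → ∀ (v : ℕ → ℕ) (ε : ℕ → Bool),
    (∀ i, i + 1 < m → v i ≠ v (i + 1) ∨ ε i = ε (i + 1)) →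
    ∀ U : Set X, @IsClopen X t U → U.Nonempty →
      ∃ V : Set X, @IsClopen X t V ∧ V.Nonempty ∧ V ⊆ U ∧
        ∀ x ∈ V, ∀ w : ℕ → X, w 0 = x →
          (∀ i, i < m → w i ∈ stepDom D f (v i) (ε i) ∧
            w (i + 1) = stepFun f g (v i) (ε i) (w i)) →
          w m ∉ V)

/-- The relation `ℜ_Θ` on `2^{<ω}`: `e ℜ_Θ e'` iff `e = e'` or
`(e, e') = (θ_n0w, θ_n1w)` for some `n` and `w`. -/
def RTheta (θ : ℕ → List Bool) (e e' : List Bool) : Prop :=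
  e = e' ∨ ∃ (n : ℕ) (w : List Bool), e = θ n ++ false :: w ∧ e' = θ n ++ true :: w

/-- The symmetrization `s(ℜ_Θ)`. -/
def sRTheta (θ : ℕ → List Bool) (e e' : List Bool) : Prop :=
  RTheta θ e e' ∨ RTheta θ e' e

open MeasureTheory Filter

instance instPolishSpaceCantor : PolishSpace Cantor where
  toSecondCountableTopology := inferInstance
  toIsCompletelyMetrizableSpace := inferInstance

/-- No element of `C` meeting the condition `T` on its initial segment has a flip in `C`. -/
def NoLink (T : Set ℕ) (C : Set Cantor) : Prop :=
  ∀ x ∈ C, ∀ n, x n = false → cardOnes x n ∈ T → fSfun n x ∉ C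

/-- The `σ`-ideal generated by the Borel sets that are independent for single flips. -/
def SigmaIndep (C : Set Cantor) : Prop :=
  ∃ 𝓑 : Set (Set Cantor), 𝓑.Countable ∧ (∀ B ∈ 𝓑, MeasurableSet B ∧ NoLink univ B) ∧ C ⊆ ⋃₀ 𝓑

/-- `T` meets every interval of length `k + 1`, for some fixed `k`. -/
def Syndetic (T : Set ℕ) : Prop :=
  ∃ k : ℕ, ∀ q : ℕ, ∃ c ∈ T, q ≤ c ∧ c ≤ q + k

lemma SigmaIndep.mono {C C' : Set Cantor} (h : SigmaIndep C') (hC : C ⊆ C') : SigmaIndep C := by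
  obtain ⟨𝓑, h1, h2, h3⟩ := h
  exact ⟨𝓑, h1, h2, hC.trans h3⟩

lemma SigmaIndep.iUnion {ι : Type*} [Countable ι] {C : ι → Set Cantor}
    (h : ∀ i, SigmaIndep (C i)) : SigmaIndep (⋃ i, C i) := by
  choose 𝓑 h1 h2 h3 using h
  refine ⟨⋃ i, 𝓑 i, countable_iUnion h1, fun B hB => ?_, iUnion_subset fun i => (h3 i).trans ?_⟩
  · obtain ⟨i, hi⟩ := mem_iUnion.1 hB
    exact h2 i B hi
  · exact sUnion_subset_sUnion (subset_iUnion 𝓑 i)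

lemma SigmaIndep.union {C C' : Set Cantor} (h : SigmaIndep C) (h' : SigmaIndep C') :
    SigmaIndep (C ∪ C') := by
  rw [union_eq_iUnion]
  exact SigmaIndep.iUnion (Bool.rec h' h)

lemma SigmaIndep.exists_measurableSet {C : Set Cantor} (h : SigmaIndep C) :
    ∃ B, C ⊆ B ∧ MeasurableSet B ∧ SigmaIndep B := by
  obtain ⟨𝓑, h1, h2, h3⟩ := h
  exact ⟨⋃₀ 𝓑, h3, MeasurableSet.sUnion h1 fun B hB => (h2 B hB).1, 𝓑, h1, h2, subset_rfl⟩

lemma continuous_fSfun (n : ℕ) : Continuous (fSfun n) :=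
  continuous_id.update n continuous_const

lemma continuous_cardOnes (n : ℕ) : Continuous fun x => cardOnes x n := by
  refine continuous_finsetSum _ fun i _ => ?_
  exact (continuous_of_discreteTopology (f := fun b : Bool => if b then (1 : ℕ) else 0)).comp
    (continuous_apply i)

lemma cardOnes_congr {x y : Cantor} {n : ℕ} (h : ∀ i < n, x i = y i) :
    cardOnes x n = cardOnes y n :=
  Finset.sum_congr rfl fun i hi => by rw [h i (Finset.mem_range.1 hi)]

lemma isClopen_apply_eq (n : ℕ) (b : Bool) : IsClopen {x : Cantor | x n = b} :=
  (isClopen_discrete {b}).preimage (continuous_apply n)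

lemma isClopen_cardOnes_mem (n : ℕ) (T : Set ℕ) : IsClopen {x : Cantor | cardOnes x n ∈ T} :=
  (isClopen_discrete T).preimage (continuous_cardOnes n)

lemma analyticSet_inter {s t : Set Cantor} (hs : AnalyticSet s) (ht : AnalyticSet t) :
    AnalyticSet (s ∩ t) := by
  rw [inter_eq_iInter]
  exact AnalyticSet.iInter (Bool.rec ht hs)

lemma measurableSet_exists_link {B : Set Cantor} (hB : MeasurableSet B) :
    MeasurableSet {x : Cantor | ∃ n, x n = false ∧ fSfun n x ∈ B} := by
  simp only [ofPred_exists]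
  exact MeasurableSet.iUnion fun n =>
    (isClopen_apply_eq n false).1.measurableSet.inter ((continuous_fSfun n).measurable hB)

lemma SigmaIndep.of_noLink_univ {C : Set Cantor} (hC : AnalyticSet C) (h : NoLink univ C) :
    SigmaIndep C := by
  have hQ : AnalyticSet (⋃ n, fSfun n '' (C ∩ {x | x n = false})) :=
    AnalyticSet.iUnion fun n => (analyticSet_inter hC
      (isClopen_apply_eq n false).1.measurableSet.analyticSet).image_of_continuous
        (continuous_fSfun n)
  have hd : Disjoint C (⋃ n, fSfun n '' (C ∩ {x | x n = false})) := by
    rw [Set.disjoint_left]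
    rintro y hy hy'
    obtain ⟨n, x, ⟨hx, hxn⟩, rfl⟩ := mem_iUnion.1 hy'
    exact h x hx n hxn trivial hy
  obtain ⟨B, hCB, hBQ, hB⟩ := hC.measurablySeparable hQ hd
  refine ⟨{B \ {x : Cantor | ∃ n, x n = false ∧ fSfun n x ∈ B}}, countable_singleton _, ?_, ?_⟩
  · rintro _ rfl
    refine ⟨hB.diff (measurableSet_exists_link hB), ?_⟩
    rintro x ⟨-, hx⟩ n hn - hy
    exact hx ⟨n, hn, hy.1⟩
  · rw [sUnion_singleton]
    refine fun x hx => ⟨hCB hx, ?_⟩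
    rintro ⟨n, hn, hy⟩
    exact Set.disjoint_left.1 hBQ (mem_iUnion.2 ⟨n, x, ⟨hx, hn⟩, rfl⟩) hy

lemma MeasureTheory.AnalyticSet.sdiff_measurableSet {C B : Set Cantor} (hC : AnalyticSet C)
    (hB : MeasurableSet B) : AnalyticSet (C \ B) :=
  analyticSet_inter hC hB.compl.analyticSet

/-- The points of `C` extending `t`. -/
def initPart (C : Set Cantor) (k : ℕ) (t : Fin k → Bool) : Set Cantor :=
  C ∩ {x | ∀ i : Fin k, x i = t i}

lemma MeasureTheory.AnalyticSet.initPart {C : Set Cantor} (hC : AnalyticSet C) (k : ℕ) (t : Fin k → Bool) :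
    AnalyticSet (initPart C k t) := by
  refine analyticSet_inter hC (MeasurableSet.analyticSet ?_)
  simp only [ofPred_forall]
  exact MeasurableSet.iInter fun i => (isClopen_apply_eq i (t i)).1.measurableSet

lemma SigmaIndep.of_initPart {C : Set Cantor} (k : ℕ)
    (h : ∀ t : Fin k → Bool, SigmaIndep (initPart C k t)) : SigmaIndep C :=
  (SigmaIndep.iUnion h).mono fun x hx => mem_iUnion.2 ⟨fun i => x i, hx, fun _ => rfl⟩

/-- The points of `C` whose flip at `n` is in `C`, with condition `T` on its initial segment. -/
def linkPart (T : Set ℕ) (C : Set Cantor) (n : ℕ) : Set Cantor :=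
  {x ∈ C | x n = false ∧ cardOnes x n ∈ T ∧ fSfun n x ∈ C}

lemma MeasureTheory.AnalyticSet.linkPart {C : Set Cantor} (hC : AnalyticSet C) (T : Set ℕ) (n : ℕ) :
    AnalyticSet (linkPart T C n) :=
  analyticSet_inter hC <| analyticSet_inter (isClopen_apply_eq n false).1.measurableSet.analyticSet <|
    analyticSet_inter (isClopen_cardOnes_mem n T).1.measurableSet.analyticSet
      (hC.preimage (continuous_fSfun n))

lemma fSfun_of_ne {n m : ℕ} (h : m ≠ n) (x : Cantor) : fSfun n x m = x m :=
  Function.update_of_ne h _ _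

@[simp] lemma fSfun_self (n : ℕ) (x : Cantor) : fSfun n x n = true :=
  Function.update_self _ _ _

lemma fSfun_comm (n m : ℕ) (x : Cantor) : fSfun n (fSfun m x) = fSfun m (fSfun n x) := by
  funext i
  by_cases h : i = n <;> by_cases h' : i = m <;> simp_all [fSfun_of_ne]

lemma cardOnes_fSfun_of_lt {n m : ℕ} (h : n < m) {x : Cantor} (hx : x n = false) :
    cardOnes (fSfun n x) m = cardOnes x m + 1 := by
  have hn : n ∈ Finset.range m := Finset.mem_range.2 h
  unfold cardOnes
  rw [← Finset.add_sum_erase _ _ hn, ← Finset.add_sum_erase _ (fun i => if x i then 1 else 0) hn,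
    Finset.sum_congr rfl (g := fun i => if x i then 1 else 0)
      fun i hi => by rw [fSfun_of_ne (Finset.ne_of_mem_erase hi)]]
  simp [hx, add_comm]

lemma SigmaIndep.of_linkPart {C : Set Cantor} (hC : AnalyticSet C) {T : Set ℕ}
    (hT : ∀ E : Set Cantor, AnalyticSet E → NoLink T E → SigmaIndep E) (l : ℕ)
    (h : ∀ n, l ≤ n → SigmaIndep (linkPart T C n)) : SigmaIndep C := by
  obtain ⟨B, hB, hBm, hBs⟩ := (SigmaIndep.iUnion fun n : {n // l ≤ n} => h n n.2).exists_measurableSet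
  refine (hBs.union (SigmaIndep.of_initPart (C := C \ B) l fun t => hT _
    ((hC.sdiff_measurableSet hBm).initPart l t) ?_)).mono fun x hx => ?_
  · rintro x ⟨⟨hx, hxB⟩, hxt⟩ n hn hnT ⟨⟨hy, -⟩, hyt⟩
    rcases lt_or_ge n l with hl | hl
    · have h1 := hyt ⟨n, hl⟩
      have h2 := hxt ⟨n, hl⟩
      simp_all
    · exact hxB (hB (mem_iUnion.2 ⟨⟨n, hl⟩, hx, hn, hnT, hy⟩))
  · by_cases hxB : x ∈ B
    · exact Or.inl hxB
    · exact Or.inr ⟨hx, hxB⟩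

/-- Sets without `T`-links are small as soon as `T` is syndetic. -/
lemma SigmaIndep.of_noLink {T : Set ℕ} (hT : Syndetic T) {C : Set Cantor} (hC : AnalyticSet C)
    (h : NoLink T C) : SigmaIndep C := by
  obtain ⟨k, hk⟩ := hT
  induction k generalizing T C with
  | zero =>
    refine SigmaIndep.of_noLink_univ hC fun x hx n hn _ => h x hx n hn ?_
    obtain ⟨c, hc, h1, h2⟩ := hk (cardOnes x n)
    rwa [show cardOnes x n = c by omega]
  | succ k ih =>
    have hk' : ∀ q, ∃ c ∈ {c | c ∈ T ∨ c + 1 ∈ T}, q ≤ c ∧ c ≤ q + k := fun q => by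
      obtain ⟨c, hc, h1, h2⟩ := hk q
      by_cases hqc : c ≤ q + k
      · exact ⟨c, Or.inl hc, h1, hqc⟩
      · exact ⟨c - 1, Or.inr (by rwa [show c - 1 + 1 = c by omega]), by omega, by omega⟩
    refine SigmaIndep.of_linkPart (T := univ) hC (fun E => SigmaIndep.of_noLink_univ) 0
      fun n _ => SigmaIndep.of_initPart (n + 1) fun t =>
        ih ((hC.linkPart univ n).initPart _ t) ?_ hk'
    rintro x ⟨⟨hx, hxn, -, hx'⟩, hxt⟩ m hm hmT ⟨⟨hy, hyn, -, hy'⟩, hyt⟩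
    have hnm : n < m := by
      by_contra hc
      have h1 := hxt ⟨m, by omega⟩
      have h2 := hyt ⟨m, by omega⟩
      simp_all
    rcases hmT with hmT | hmT
    · exact h x hx m hm hmT hy
    · refine h _ hx' m ?_ ?_ (fSfun_comm m n x ▸ hy')
      · rwa [fSfun_of_ne hnm.ne']
      · rwa [cardOnes_fSfun_of_lt hnm hxn]

lemma exists_linkPart_not_sigmaIndep {T : Set ℕ} (hT : Syndetic T) {C : Set Cantor}
    (hC : AnalyticSet C) (h : ¬ SigmaIndep C) (l : ℕ) :
    ∃ n, l ≤ n ∧ ¬ SigmaIndep (linkPart T C n) := by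
  by_contra! hc
  exact h (SigmaIndep.of_linkPart hC (fun E hE => SigmaIndep.of_noLink hT hE) l hc)

lemma exists_cylinder_subset {U : Set Cantor} (hU : IsOpen U) {x : Cantor} (hx : x ∈ U) :
    ∃ n, {y : Cantor | ∀ i < n, y i = x i} ⊆ U := by
  obtain ⟨I, u, hu, hIU⟩ := isOpen_pi_iff.1 hU x hx
  refine ⟨I.sup id + 1, fun y hy => hIU fun i hi => ?_⟩
  have hi' : i < I.sup id + 1 := Nat.lt_succ_of_le (Finset.le_sup (f := id) hi)
  rw [hy i hi']
  exact (hu i hi).2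

lemma isOpen_cylinder (x : Cantor) (n : ℕ) : IsOpen {y : Cantor | ∀ i < n, y i = x i} := by
  have : {y : Cantor | ∀ i < n, y i = x i} = ⋂ i ∈ Finset.range n, {y | y i = x i} := by
    ext; simp
  rw [this]
  exact isOpen_biInter_finset fun i _ => (isClopen_apply_eq i (x i)).2

/-- Switching the `n`-th coordinate, as a homeomorphism. -/
def toggle (n : ℕ) : Cantor ≃ₜ Cantor where
  toFun x := Function.update x n (!x n)
  invFun x := Function.update x n (!x n)
  left_inv x := by simp
  right_inv x := by simp
  continuous_toFun := continuous_id.update n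
    ((continuous_of_discreteTopology (f := not)).comp (continuous_apply n))
  continuous_invFun := continuous_id.update n
    ((continuous_of_discreteTopology (f := not)).comp (continuous_apply n))

lemma toggle_apply (n : ℕ) (x : Cantor) : toggle n x = Function.update x n (!x n) := rfl

lemma not_sigmaIndep_univ : ¬ SigmaIndep (univ : Set Cantor) := by
  rintro ⟨𝓑, h1, h2, h3⟩
  obtain ⟨B, hB, hBm⟩ : ∃ B ∈ 𝓑, ¬ IsMeagre B := by
    by_contra! hc
    have : IsMeagre (univ : Set Cantor) := by
      refine IsMeagre.mono h3 ?_
      rw [sUnion_eq_biUnion]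
      exact isMeagre_biUnion h1 hc
    exact not_isMeagre_of_isOpen isOpen_univ univ_nonempty this
  obtain ⟨U, hU, hBU⟩ := (h2 B hB).1.residualEq_isOpen
  have hUne : U.Nonempty := by
    by_contra hc
    rw [not_nonempty_iff_eq_empty.1 hc] at hBU
    refine hBm ?_
    filter_upwards [hBU] with y hy hyB
    exact (hy.mp hyB : y ∈ (∅ : Set Cantor))
  obtain ⟨x, hx⟩ := hUne
  obtain ⟨n, hn⟩ := exists_cylinder_subset hU hx
  have hg := (tendsto_residual_of_isOpenMap (toggle n).continuous (toggle n).isOpenMap).eventually hBU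
  obtain ⟨y, ⟨hy1, hy2⟩, hy⟩ := (dense_of_mem_residual (hBU.and hg)).inter_open_nonempty _
    (isOpen_cylinder x n) ⟨x, fun _ _ => rfl⟩ |>.imp fun _ => And.symm
  have hyB : y ∈ B := hy1.mpr (hn hy)
  have hgy : toggle n y ∈ B := hy2.mpr (hn fun i hi => by
    rw [toggle_apply, Function.update_of_ne hi.ne, hy i hi])
  rw [toggle_apply] at hgy
  cases hyn : y n
  · refine (h2 B hB).2 y hyB n hyn trivial ?_
    simpa [hyn, fSfun] using hgy
  · refine (h2 B hB).2 _ hgy n (by simp [hyn]) trivial ?_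
    rw [show fSfun n _ = y by simp [fSfun, ← hyn]]
    exact hyB

/-- Adding ones to `γ` at the positions `N j` for which `x j = true`. -/
noncomputable def putOnes (N : ℕ → ℕ) (γ x : Cantor) : Cantor :=
  fun i => γ i || @decide (∃ j, N j = i ∧ x j = true) (Classical.dec _)

lemma putOnes_eq_true {N : ℕ → ℕ} {γ x : Cantor} {i : ℕ} :
    putOnes N γ x i = true ↔ γ i = true ∨ ∃ j, N j = i ∧ x j = true := by
  simp [putOnes]

lemma putOnes_apply {N : ℕ → ℕ} (hN : Function.Injective N) {γ : Cantor}
    (hγ : ∀ j, γ (N j) = false) (x : Cantor) (j : ℕ) : putOnes N γ x (N j) = x j := by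
  rw [Bool.eq_iff_iff, putOnes_eq_true]
  simp [hγ, hN.eq_iff]

lemma putOnes_fSfun {N : ℕ → ℕ} (γ x : Cantor) (j : ℕ) :
    putOnes N γ (fSfun j x) = fSfun (N j) (putOnes N γ x) := by
  funext i
  rw [Bool.eq_iff_iff, putOnes_eq_true]
  by_cases hi : i = N j
  · subst hi
    simp only [fSfun_self, iff_true]
    exact Or.inr ⟨j, rfl, fSfun_self _ _⟩
  · rw [fSfun_of_ne hi, putOnes_eq_true]
    refine or_congr_right (exists_congr fun m => and_congr_right fun hm => ?_)
    rw [fSfun_of_ne]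
    rintro rfl
    exact hi hm.symm

lemma cardOnes_eq_card (x : Cantor) (n : ℕ) :
    cardOnes x n = ((Finset.range n).filter fun i => x i = true).card := by
  rw [cardOnes, Finset.card_filter]

lemma cardOnes_putOnes {N : ℕ → ℕ} (hN : StrictMono N) {γ : Cantor}
    (hγ : ∀ j, γ (N j) = false) (x : Cantor) (k : ℕ) :
    cardOnes (putOnes N γ x) (N k) = cardOnes γ (N k) + cardOnes x k := by
  classical
  rw [cardOnes_eq_card, cardOnes_eq_card, cardOnes_eq_card x,
    ← Finset.card_image_of_injective ((Finset.range k).filter fun i => x i = true) hN.injective, ← Finset.card_union_of_disjoint]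
  · congr 1
    ext i
    simp only [Finset.mem_filter, Finset.mem_range, Finset.mem_union, Finset.mem_image,
      putOnes_eq_true]
    constructor
    · rintro ⟨hi, h | ⟨j, rfl, hj⟩⟩
      · exact Or.inl ⟨hi, h⟩
      · exact Or.inr ⟨j, ⟨hN.lt_iff_lt.1 hi, hj⟩, rfl⟩
    · rintro (⟨hi, h⟩ | ⟨j, ⟨hj, hx⟩, rfl⟩)
      · exact ⟨hi, Or.inl h⟩
      · exact ⟨hN hj, Or.inr ⟨j, rfl, hx⟩⟩
  · rw [Finset.disjoint_left]
    rintro i hi hi'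
    obtain ⟨j, -, rfl⟩ := Finset.mem_image.1 hi'
    simp [hγ] at hi

lemma cardOnes_le (x : Cantor) (n : ℕ) : cardOnes x n ≤ n := by
  rw [cardOnes_eq_card]
  exact (Finset.card_filter_le _ _).trans (Finset.card_range n).le

lemma mem_ASet {S : Set ℕ} {x y : Cantor} :
    (x, y) ∈ ASet S ↔ ∃ n, x n = false ∧ cardOnes x n ∈ S ∧ y = fSfun n x := by
  simp [ASet, unionGraphs, graphRel, DSdom, and_assoc]

/-- The positions at which the pattern `S ∩ [0, p]` occurs in `S`. -/
def patternSet (S : Set ℕ) (p : ℕ) : Set ℕ := {c | ∀ j ≤ p, c + j ∈ S ↔ j ∈ S}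

lemma mem_ASet_putOnes {S : Set ℕ} {N : ℕ → ℕ} (hN : StrictMono N) {γ : Cantor}
    (hγ : ∀ j, γ (N j) = false) (hS : ∀ k, cardOnes γ (N k) ∈ patternSet S k) (x y : Cantor) :
    (putOnes N γ x, putOnes N γ y) ∈ ASet S ↔ (x, y) ∈ ASet S := by
  have happ := fun x j => putOnes_apply hN.injective hγ x j
  rw [mem_ASet, mem_ASet]
  constructor
  · rintro ⟨n, hn, hc, hy⟩
    have hyn : putOnes N γ y n = true := by rw [hy, fSfun_self]
    obtain ⟨k, rfl⟩ : ∃ k, N k = n := by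
      rcases putOnes_eq_true.1 hyn with h | ⟨k, hk, -⟩
      · rw [putOnes_eq_true.2 (Or.inl h)] at hn
        exact absurd hn (by simp)
      · exact ⟨k, hk⟩
    rw [cardOnes_putOnes hN hγ, hS k _ (cardOnes_le x k)] at hc
    refine ⟨k, by rwa [happ] at hn, hc, funext fun j => ?_⟩
    rw [← happ y, hy, ← putOnes_fSfun, happ]
  · rintro ⟨k, hk, hc, rfl⟩
    refine ⟨N k, by rwa [happ], ?_, putOnes_fSfun _ _ _⟩
    rwa [cardOnes_putOnes hN hγ, hS k _ (cardOnes_le x k)]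

/-- The sequence extending `a` by zeros. -/
def extendZero {k : ℕ} (a : Fin k → Bool) : Cantor :=
  fun i => if h : i < k then a ⟨i, h⟩ else false

/-- The sequence `x` with all coordinates from `k` on set to zero. -/
def trunc (k : ℕ) (x : Cantor) : Cantor := extendZero fun i : Fin k => x i

lemma trunc_of_lt {k i : ℕ} (h : i < k) (x : Cantor) : trunc k x i = x i := by
  simp [trunc, extendZero, h]

lemma trunc_of_le {k i : ℕ} (h : k ≤ i) (x : Cantor) : trunc k x i = false := by
  simp [trunc, extendZero, h.not_gt]

lemma trunc_extendZero {k : ℕ} (a : Fin k → Bool) : trunc k (extendZero a) = extendZero a := by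
  funext i
  by_cases h : i < k <;> simp [trunc, extendZero, h]

lemma trunc_succ_of_false {k : ℕ} {x : Cantor} (h : x k = false) : trunc (k + 1) x = trunc k x := by
  funext i
  rcases lt_trichotomy i k with hi | rfl | hi
  · rw [trunc_of_lt hi, trunc_of_lt (by omega)]
  · rw [trunc_of_lt (by omega), trunc_of_le le_rfl, h]
  · rw [trunc_of_le hi, trunc_of_le hi.le]

lemma trunc_succ_of_true {k : ℕ} {x : Cantor} (h : x k = true) :
    trunc (k + 1) x = fSfun k (trunc k x) := by
  funext i
  rcases lt_trichotomy i k with hi | rfl | hi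
  · rw [fSfun_of_ne hi.ne, trunc_of_lt hi, trunc_of_lt (by omega)]
  · rw [trunc_of_lt (by omega), fSfun_self, h]
  · rw [fSfun_of_ne hi.ne', trunc_of_le hi, trunc_of_le hi.le]

lemma putOnes_fSfun_base {N : ℕ → ℕ} (n : ℕ) (γ x : Cantor) :
    putOnes N (fSfun n γ) x = fSfun n (putOnes N γ x) := by
  funext i
  by_cases hi : i = n
  · subst hi
    simp [putOnes]
  · simp [putOnes, fSfun_of_ne hi]

lemma putOnes_trunc_congr {N N' : ℕ → ℕ} {k : ℕ} (h : ∀ i < k, N i = N' i) (γ x : Cantor) :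
    putOnes N γ (trunc k x) = putOnes N' γ (trunc k x) := by
  funext i
  rw [Bool.eq_iff_iff, putOnes_eq_true, putOnes_eq_true]
  refine or_congr_right (exists_congr fun j => and_congr_left fun hj => ?_)
  rw [h]
  by_contra hjk
  rw [trunc_of_le (not_lt.1 hjk)] at hj
  cases hj

lemma continuous_putOnes (N : ℕ → ℕ) (x : Cantor) : Continuous fun γ => putOnes N γ x :=
  continuous_pi fun i => (continuous_of_discreteTopology
    (f := fun b : Bool => b || @decide (∃ j, N j = i ∧ x j = true) (Classical.dec _))).comp
      (continuous_apply i)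

/-- A finite approximation in the construction of an embedded copy of the Cantor space:
`label` gives the approximations of the lifted points, `pos` the coordinates that are used
and `base` the set of possible base points. -/
structure FusionState where
  label : Cantor → Bool → ℕ → ℕ
  pos : ℕ → ℕ
  base : Set Cantor

structure FusionState.Valid (S : Set ℕ) (v : (ℕ → ℕ) → Cantor × Bool) (k : ℕ)
    (s : FusionState) : Prop where
  analytic : AnalyticSet s.base
  large : ¬ SigmaIndep s.base
  lift : ∀ γ ∈ s.base, ∀ x ε, ∃ z : ℕ → ℕ, (∀ i < k, z i = s.label x ε i) ∧
    v z = (putOnes s.pos γ (trunc k x), ε)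
  pos_false : ∀ γ ∈ s.base, ∀ i < k, γ (s.pos i) = false
  pos_lt : ∀ i j, i < j → j < k → s.pos i < s.pos j
  pattern : ∀ γ ∈ s.base, ∀ i < k, cardOnes γ (s.pos i) ∈ patternSet S i
  agree : ∀ γ ∈ s.base, ∀ γ' ∈ s.base, ∀ i < k, γ i = γ' i
  label_congr : ∀ x y ε i, i < k → (∀ j < i, x j = y j) → s.label x ε i = s.label y ε i

structure FusionState.Extends (k : ℕ) (s s' : FusionState) : Prop where
  label_eq : ∀ x ε, ∀ i < k, s'.label x ε i = s.label x ε i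
  pos_eq : ∀ i < k, s'.pos i = s.pos i
  base_subset : s'.base ⊆ s.base

/-- The base points whose lifts can be chosen with `k`-th coordinates prescribed by `c`. -/
def labelPart (v : (ℕ → ℕ) → Cantor × Bool) (k : ℕ) (s : FusionState)
    (c : (Fin k → Bool) × Bool → ℕ) : Set Cantor :=
  {γ ∈ s.base | ∀ q : (Fin k → Bool) × Bool, ∃ z : ℕ → ℕ,
    ((∀ i < k, z i = s.label (extendZero q.1) q.2 i) ∧ z k = c q) ∧
      v z = (putOnes s.pos γ (extendZero q.1), q.2)}

lemma FusionState.Valid.analyticSet_labelPart {S : Set ℕ} {v : (ℕ → ℕ) → Cantor × Bool}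
    (hv : Continuous v) {k : ℕ} {s : FusionState} (h : s.Valid S v k)
    (c : (Fin k → Bool) × Bool → ℕ) : AnalyticSet (labelPart v k s c) := by
  have heq : labelPart v k s c = s.base ∩ ⋂ q : (Fin k → Bool) × Bool,
      (fun γ => (putOnes s.pos γ (extendZero q.1), q.2)) ⁻¹' (v '' {z |
        (∀ i < k, z i = s.label (extendZero q.1) q.2 i) ∧ z k = c q}) := by
    ext γ
    simp only [labelPart, mem_inter_iff, mem_iInter]
    rfl
  rw [heq]
  refine analyticSet_inter h.analytic (AnalyticSet.iInter fun q => ?_)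
  have hcl : IsClosed {z : ℕ → ℕ |
      (∀ i < k, z i = s.label (extendZero q.1) q.2 i) ∧ z k = c q} := by
    have hset : {z : ℕ → ℕ | (∀ i < k, z i = s.label (extendZero q.1) q.2 i) ∧ z k = c q} =
        (⋂ i, ⋂ _ : i < k, {z | z i = s.label (extendZero q.1) q.2 i}) ∩ {z | z k = c q} := by
      ext z
      simp
    rw [hset]
    exact (isClosed_iInter fun i => isClosed_iInter fun _ =>
      isClosed_eq (continuous_apply i) continuous_const).inter
      (isClosed_eq (continuous_apply k) continuous_const)
  have := (hcl.analyticSet.image_of_continuous hv).preimage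
    ((continuous_putOnes s.pos (extendZero q.1)).prodMk (continuous_const (y := q.2)))
  exact this

lemma FusionState.Valid.exists_labelPart {S : Set ℕ} {v : (ℕ → ℕ) → Cantor × Bool}
    {k : ℕ} {s : FusionState} (h : s.Valid S v k) :
    ∃ c, ¬ SigmaIndep (labelPart v k s c) := by
  by_contra! hc
  refine h.large ((SigmaIndep.iUnion hc).mono fun γ hγ => ?_)
  choose z hz hvz using fun q : (Fin k → Bool) × Bool => h.lift γ hγ (extendZero q.1) q.2
  refine mem_iUnion.2 ⟨fun q => z q k, hγ, fun q => ⟨z q, ⟨hz q, rfl⟩, ?_⟩⟩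
  rw [hvz, trunc_extendZero]

lemma FusionState.Valid.exists_extends {S : Set ℕ} (hS : ∀ p, Syndetic (patternSet S p))
    {v : (ℕ → ℕ) → Cantor × Bool} (hv : Continuous v) {k : ℕ} {s : FusionState}
    (h : s.Valid S v k) : ∃ s' : FusionState, s'.Valid S v (k + 1) ∧ s.Extends k s' := by
  obtain ⟨c, hc⟩ := h.exists_labelPart
  obtain ⟨t, ht⟩ : ∃ t, ¬ SigmaIndep (initPart (labelPart v k s c) (k + 1) t) := by
    by_contra! hcon
    exact hc (SigmaIndep.of_initPart _ hcon)
  have hEa := (h.analyticSet_labelPart hv c).initPart (k + 1) t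
  set E := initPart (labelPart v k s c) (k + 1) t with hE
  obtain ⟨n, hn, hnE⟩ := exists_linkPart_not_sigmaIndep (hS k) hEa ht
    (∑ i ∈ Finset.range k, (s.pos i + 1))
  have hposn : ∀ i < k, s.pos i < n := fun i hi => by
    have := Finset.single_le_sum (f := fun i => s.pos i + 1) (fun _ _ => Nat.zero_le _)
      (Finset.mem_range.2 hi)
    omega
  let pos' : ℕ → ℕ := fun i => if i < k then s.pos i else n
  let label' : Cantor → Bool → ℕ → ℕ := fun x ε i =>
    if i < k then s.label x ε i else c (fun j => x j, ε)
  have hpos' : ∀ i < k, pos' i = s.pos i := fun i hi => if_pos hi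
  have hpos'k : pos' k = n := if_neg (lt_irrefl k)
  have hlabel' : ∀ x ε, ∀ i < k, label' x ε i = s.label x ε i := fun x ε i hi => if_pos hi
  have hlabel'k : ∀ x ε, label' x ε k = c (fun j => x j, ε) := fun x ε => if_neg (lt_irrefl k)
  have hbase : linkPart (patternSet S k) E n ⊆ s.base := fun γ hγ => hγ.1.1.1
  have hlift : ∀ γ ∈ E, ∀ x ε, ∃ z : ℕ → ℕ, (∀ i < k + 1, z i = label' x ε i) ∧
      v z = (putOnes s.pos γ (trunc k x), ε) := by
    intro γ hγ x ε
    obtain ⟨z, ⟨hz, hzk⟩, hvz⟩ := hγ.1.2 (fun j => x j, ε)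
    refine ⟨z, fun i hi => ?_, hvz⟩
    rcases Nat.lt_succ_iff_lt_or_eq.1 hi with hi | rfl
    · rw [hz i hi, hlabel' x ε i hi]
      refine h.label_congr _ _ _ _ hi fun j hj => ?_
      exact trunc_of_lt (hj.trans hi) x
    · rw [hzk, hlabel'k]
  refine ⟨⟨label', pos', linkPart (patternSet S k) E n⟩, ⟨hEa.linkPart _ _, hnE, ?_, ?_, ?_, ?_,
    ?_, ?_⟩, ⟨hlabel', hpos', hbase⟩⟩
  · intro γ hγ x ε
    cases hx : x k
    · obtain ⟨z, hz, hvz⟩ := hlift γ hγ.1 x ε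
      refine ⟨z, hz, ?_⟩
      change v z = (putOnes pos' γ (trunc (k + 1) x), ε)
      rw [hvz, trunc_succ_of_false hx, putOnes_trunc_congr hpos']
    · obtain ⟨z, hz, hvz⟩ := hlift (fSfun n γ) hγ.2.2.2 x ε
      refine ⟨z, hz, ?_⟩
      change v z = (putOnes pos' γ (trunc (k + 1) x), ε)
      rw [hvz, trunc_succ_of_true hx, putOnes_fSfun, putOnes_trunc_congr hpos', hpos'k,
        putOnes_fSfun_base]
  · intro γ hγ i hi
    rcases Nat.lt_succ_iff_lt_or_eq.1 hi with hi | rfl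
    · exact (congrArg γ (hpos' i hi)).trans (h.pos_false γ (hbase hγ) i hi)
    · exact (congrArg γ hpos'k).trans hγ.2.1
  · intro i j hij hj
    rcases Nat.lt_succ_iff_lt_or_eq.1 hj with hj | rfl
    · simpa only [hpos' i (hij.trans hj), hpos' j hj] using h.pos_lt i j hij hj
    · simpa only [hpos' i hij, hpos'k] using hposn i hij
  · intro γ hγ i hi
    rcases Nat.lt_succ_iff_lt_or_eq.1 hi with hi | rfl
    · simpa only [hpos' i hi] using h.pattern γ (hbase hγ) i hi
    · simpa only [hpos'k] using hγ.2.2.1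
  · intro γ hγ γ' hγ' i hi
    exact (hγ.1.2 ⟨i, hi⟩).trans (hγ'.1.2 ⟨i, hi⟩).symm
  · intro x y ε i hi hxy
    rcases Nat.lt_succ_iff_lt_or_eq.1 hi with hi | rfl
    · simpa only [hlabel' _ _ i hi] using h.label_congr x y ε i hi hxy
    · simp only [hlabel'k]
      congr 2
      exact funext fun j => hxy j j.2

theorem exists_fusion {S : Set ℕ} (hS : ∀ p, Syndetic (patternSet S p))
    {v : (ℕ → ℕ) → Cantor × Bool} (hv : Continuous v)
    (hC : ¬ SigmaIndep {x | ∀ ε, ∃ z, v z = (x, ε)}) :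
    ∃ (N : ℕ → ℕ) (γ : Cantor) (h : Cantor × Bool → ℕ → ℕ),
      StrictMono N ∧ (∀ j, γ (N j) = false) ∧ (∀ k, cardOnes γ (N k) ∈ patternSet S k) ∧
      Continuous h ∧ ∀ x ε, v (h (x, ε)) = (putOnes N γ x, ε) := by
  have hv0 : FusionState.Valid S v 0 ⟨fun _ _ _ => 0, id, {x | ∀ ε, ∃ z, v z = (x, ε)}⟩ := by
    refine ⟨?_, hC, fun γ hγ x ε => ?_, by simp, by simp, by simp, by simp, by simp⟩
    · simp only [ofPred_forall]
      exact AnalyticSet.iInter fun ε => (analyticSet_range_of_polishSpace hv).preimage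
        (continuous_id.prodMk (continuous_const (y := ε)))
    · obtain ⟨z, hz⟩ := hγ ε
      refine ⟨z, by simp, hz.trans ?_⟩
      congr 1
      funext i
      simp [putOnes, trunc_of_le]
  choose! next hnext using fun k s => FusionState.Valid.exists_extends hS hv (k := k) (s := s)
  let σ : ℕ → FusionState := fun k =>
    Nat.rec ⟨fun _ _ _ => 0, id, {x | ∀ ε, ∃ z, v z = (x, ε)}⟩ next k
  have hσ : ∀ k, (σ k).Valid S v k := fun k => by
    induction k with
    | zero => exact hv0
    | succ k ih => exact (hnext k _ ih).1
  have hext : ∀ k, (σ k).Extends k (σ (k + 1)) := fun k => (hnext k _ (hσ k)).2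
  have hlabel : ∀ x ε i k, i < k → (σ k).label x ε i = (σ (i + 1)).label x ε i := by
    intro x ε i k hik
    induction k, hik using Nat.le_induction with
    | base => rfl
    | succ k hk ih => rw [(hext k).label_eq x ε i hk, ih]
  have hpos : ∀ i k, i < k → (σ k).pos i = (σ (i + 1)).pos i := by
    intro i k hik
    induction k, hik using Nat.le_induction with
    | base => rfl
    | succ k hk ih => rw [(hext k).pos_eq i hk, ih]
  have hbase : Antitone fun k => (σ k).base := antitone_nat_of_succ_le fun k => (hext k).base_subset
  have hne : ∀ k, (σ k).base.Nonempty := fun k => by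
    by_contra hc
    refine (hσ k).large ?_
    rw [not_nonempty_iff_eq_empty.1 hc]
    exact ⟨∅, countable_empty, by simp, by simp⟩
  choose g hg using hne
  let γ : Cantor := fun i => g (i + 1) i
  let N : ℕ → ℕ := fun i => (σ (i + 1)).pos i
  have hgγ : ∀ i k, i < k → g k i = γ i := fun i k hik =>
    (hσ (i + 1)).agree _ (hbase (Nat.succ_le_of_lt hik) (hg k)) _ (hg (i + 1)) i (Nat.lt_succ_self i)
  have hN : StrictMono N := strictMono_nat_of_lt_succ fun i => by
    have := (hσ (i + 2)).pos_lt i (i + 1) (Nat.lt_succ_self i) (Nat.lt_succ_self _)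
    rwa [hpos i (i + 2) (by omega)] at this
  have hNle : ∀ i, i ≤ N i := fun i => hN.le_apply
  let h : Cantor × Bool → ℕ → ℕ := fun p i => (σ (i + 1)).label p.1 p.2 i
  refine ⟨N, γ, h, hN, fun j => ?_, fun k => ?_, ?_, fun x ε => ?_⟩
  · rw [← hgγ (N j) (N j + 1) (Nat.lt_succ_self _)]
    have hj : j < N j + 1 := Nat.lt_succ_of_le (hNle j)
    have := (hσ (N j + 1)).pos_false _ (hg (N j + 1)) j hj
    rwa [hpos j _ hj] at this
  · rw [← cardOnes_congr fun i hi => hgγ i (N k + 1) (by omega)]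
    have hk : k < N k + 1 := Nat.lt_succ_of_le (hNle k)
    have := (hσ (N k + 1)).pattern _ (hg (N k + 1)) k hk
    rwa [hpos k _ hk] at this
  · refine continuous_pi fun i => ?_
    have : (fun p => h p i) =
        (fun q : (Fin i → Bool) × Bool => (σ (i + 1)).label (extendZero q.1) q.2 i) ∘
          fun p : Cantor × Bool => (fun j : Fin i => p.1 j, p.2) := by
      funext p
      exact (hσ (i + 1)).label_congr _ _ _ i (Nat.lt_succ_self i) fun j hj =>
        (trunc_of_lt hj p.1).symm
    rw [this]
    refine continuous_of_discreteTopology.comp (Continuous.prodMk ?_ continuous_snd)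
    exact continuous_pi fun j => (continuous_apply (j : ℕ)).comp continuous_fst
  · choose z hz hvz using fun k => (hσ k).lift (g k) (hg k) x ε
    have hzlim : Tendsto z atTop (𝓝 (h (x, ε))) := by
      refine tendsto_pi_nhds.2 fun i => tendsto_const_nhds.congr' ?_
      filter_upwards [eventually_gt_atTop i] with k hk
      rw [hz k i hk, hlabel x ε i k hk]
    refine tendsto_nhds_unique ((hv.tendsto _).comp hzlim) ?_
    simp only [Function.comp_def, hvz]
    refine Tendsto.prodMk_nhds (tendsto_pi_nhds.2 fun i => tendsto_const_nhds.congr' ?_)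
      tendsto_const_nhds
    filter_upwards [eventually_gt_atTop i] with k hk
    rw [putOnes_trunc_congr fun j hj => hpos j k hj, Bool.eq_iff_iff, putOnes_eq_true,
      putOnes_eq_true, hgγ i k hk]
    refine or_congr_right (exists_congr fun j => and_congr_right fun hj => ?_)
    rw [trunc_of_lt (((hNle j).trans hj.le).trans_lt hk)]

/-- `A` is a countable union of rectangles with measurable sides. -/
def IsRectUnion {Z : Type*} [MeasurableSpace Z] (A : Set (Z × Z)) : Prop :=
  ∃ 𝓡 : Set (Set Z × Set Z), 𝓡.Countable ∧
    (∀ p ∈ 𝓡, MeasurableSet p.1 ∧ MeasurableSet p.2) ∧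
    ∀ z, z ∈ A ↔ ∃ p ∈ 𝓡, z.1 ∈ p.1 ∧ z.2 ∈ p.2

lemma IsOpen.exists_countable_rects {X Y : Type*} [TopologicalSpace X] [TopologicalSpace Y]
    [SecondCountableTopology X] [SecondCountableTopology Y] {U : Set (X × Y)} (hU : IsOpen U) :
    ∃ 𝓡 : Set (Set X × Set Y), 𝓡.Countable ∧ (∀ p ∈ 𝓡, IsOpen p.1 ∧ IsOpen p.2) ∧
      ∀ z, z ∈ U ↔ ∃ p ∈ 𝓡, z.1 ∈ p.1 ∧ z.2 ∈ p.2 := by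
  have hX := TopologicalSpace.isBasis_countableBasis X
  have hY := TopologicalSpace.isBasis_countableBasis Y
  refine ⟨{p ∈ TopologicalSpace.countableBasis X ×ˢ TopologicalSpace.countableBasis Y |
    p.1 ×ˢ p.2 ⊆ U}, (((TopologicalSpace.countable_countableBasis X).prod
      (TopologicalSpace.countable_countableBasis Y))).mono (sep_subset _ _),
    fun p hp => ⟨hX.isOpen hp.1.1, hY.isOpen hp.1.2⟩, fun z => ⟨fun hz => ?_, ?_⟩⟩
  · obtain ⟨s, ⟨a, ha, b, hb, rfl⟩, hzs, hs⟩ := (hX.prod hY).exists_subset_of_mem_open hz hU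
    exact ⟨(a, b), ⟨⟨ha, hb⟩, hs⟩, hzs⟩
  · rintro ⟨p, hp, hz⟩
    exact hp.2 hz

lemma IsOpen.isRectUnion {Z : Type*} [TopologicalSpace Z] [SecondCountableTopology Z]
    [MeasurableSpace Z] [OpensMeasurableSpace Z] {U : Set (Z × Z)} (hU : IsOpen U) :
    IsRectUnion U := by
  obtain ⟨𝓡, h1, h2, h3⟩ := hU.exists_countable_rects
  exact ⟨𝓡, h1, fun p hp => ⟨(h2 p hp).1.measurableSet, (h2 p hp).2.measurableSet⟩, h3⟩

lemma IsRectUnion.union {Z : Type*} [MeasurableSpace Z] {A B : Set (Z × Z)} (hA : IsRectUnion A)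
    (hB : IsRectUnion B) : IsRectUnion (A ∪ B) := by
  obtain ⟨𝓡, h1, h2, h3⟩ := hA
  obtain ⟨𝓠, k1, k2, k3⟩ := hB
  refine ⟨𝓡 ∪ 𝓠, h1.union k1, fun p hp => hp.elim (h2 p) (k2 p), fun z => ?_⟩
  simp only [mem_union, h3, k3, or_and_right, exists_or]

lemma IsRectUnion.preimage {Z W : Type*} [MeasurableSpace Z] [MeasurableSpace W]
    {A : Set (W × W)} (hA : IsRectUnion A) {u : Z → W} (hu : Measurable u) :
    IsRectUnion ((fun p : Z × Z => (u p.1, u p.2)) ⁻¹' A) := by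
  obtain ⟨𝓡, h1, h2, h3⟩ := hA
  refine ⟨(fun p => (u ⁻¹' p.1, u ⁻¹' p.2)) '' 𝓡, h1.image _, ?_, fun z => ?_⟩
  · rintro _ ⟨p, hp, rfl⟩
    exact ⟨hu (h2 p hp).1, hu (h2 p hp).2⟩
  · simp only [mem_preimage, h3, exists_mem_image]

lemma potClosed_iff {Z : Type} [tZ : TopologicalSpace Z] [PolishSpace Z] [MeasurableSpace Z]
    [BorelSpace Z] {A : Set (Z × Z)} : PotClosed tZ tZ A ↔ IsRectUnion Aᶜ := by
  have hZ : ‹MeasurableSpace Z› = @borel Z tZ := BorelSpace.measurable_eq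
  constructor
  · rintro ⟨σ, τ, hσ, hτ, hσP, hτP, hA⟩
    obtain ⟨𝓡, h1, h2, h3⟩ := @IsOpen.exists_countable_rects Z Z σ τ inferInstance inferInstance
      Aᶜ (@IsClosed.isOpen_compl _ (@instTopologicalSpaceProd Z Z σ τ) A hA)
    refine ⟨𝓡, h1, fun p hp => ⟨?_, ?_⟩, h3⟩
    · rw [hZ, ← borel_eq_borel_of_le hσP ‹@PolishSpace Z tZ› hσ]
      exact MeasurableSpace.measurableSet_generateFrom (h2 p hp).1
    · rw [hZ, ← borel_eq_borel_of_le hτP ‹@PolishSpace Z tZ› hτ]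
      exact MeasurableSpace.measurableSet_generateFrom (h2 p hp).2
  · rintro ⟨𝓡, h1, h2, h3⟩
    have := h1.to_subtype
    choose m hm hmP _ hmo using fun p : 𝓡 => (h2 p p.2).1.isClopenable
    choose m' hm' hmP' _ hmo' using fun p : 𝓡 => (h2 p p.2).2.isClopenable
    obtain ⟨σ, hσm, hσ, hσP⟩ := PolishSpace.exists_polishSpace_forall_le m hm hmP
    obtain ⟨τ, hτm, hτ, hτP⟩ :=
      PolishSpace.exists_polishSpace_forall_le (t := tZ) m' hm' hmP'
    refine ⟨σ, τ, hσ, hτ, hσP, hτP, ?_⟩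
    let : TopologicalSpace (Z × Z) := @instTopologicalSpaceProd Z Z σ τ
    refine ⟨?_⟩
    have : Aᶜ = ⋃ p : 𝓡, p.1.1 ×ˢ p.1.2 := by
      ext z
      simp only [h3, mem_iUnion, mem_prod, Subtype.exists, exists_prop]
    rw [this]
    exact isOpen_iUnion fun p =>
      @IsOpen.prod Z Z σ τ _ _ (hσm p _ (hmo p)) (hτm p _ (hmo' p))

lemma Measurable.exists_continuous_surjective {Z W : Type*} [tZ : TopologicalSpace Z]
    [PolishSpace Z] [MeasurableSpace Z] [BorelSpace Z] [Nonempty Z] [TopologicalSpace W]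
    [SecondCountableTopology W] [MeasurableSpace W] [OpensMeasurableSpace W] {u : Z → W}
    (hu : Measurable u) :
    ∃ f : (ℕ → ℕ) → Z, Continuous f ∧ f.Surjective ∧ Continuous (u ∘ f) := by
  obtain ⟨t, ht, hut, htP⟩ := hu.exists_continuous
  obtain ⟨f, hf, hfs⟩ := @PolishSpace.exists_nat_nat_continuous_surjective Z t htP ‹_›
  exact ⟨f, @continuous_le_rng _ _ _ _ t tZ ht hf, hfs, @Continuous.comp _ _ _ _ t _ _ _ hut hf⟩

theorem exists_measurable_fusion {S : Set ℕ} (hS : ∀ p, Syndetic (patternSet S p))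
    {Z : Type*} [tZ : TopologicalSpace Z] [PolishSpace Z] [MeasurableSpace Z] [BorelSpace Z]
    {u : Z → Cantor × Bool} (hu : Measurable u)
    (hC : ¬ SigmaIndep {x | ∀ ε, ∃ z, u z = (x, ε)}) :
    ∃ (N : ℕ → ℕ) (γ : Cantor) (h : Cantor × Bool → Z),
      StrictMono N ∧ (∀ j, γ (N j) = false) ∧ (∀ k, cardOnes γ (N k) ∈ patternSet S k) ∧
      Measurable h ∧ ∀ x ε, u (h (x, ε)) = (putOnes N γ x, ε) := by
  have hZ : Nonempty Z := by
    by_contra hZ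
    rw [not_nonempty_iff] at hZ
    exact hC ⟨∅, countable_empty, by simp, by simp⟩
  obtain ⟨f, hf, hfs, hv⟩ := hu.exists_continuous_surjective
  obtain ⟨N, γ, h, hN, hγ, hp, hh, hvh⟩ := exists_fusion hS hv (by
    convert hC using 7 with x ε
    exact ⟨fun ⟨z, hz⟩ => ⟨f z, hz⟩, fun ⟨z, hz⟩ => (hfs z).imp fun y hy => by simpa [hy] using hz⟩)
  exact ⟨N, γ, f ∘ h, hN, hγ, hp, (hf.comp hh).measurable, hvh⟩

/-- The partial order on `2^ω × 2` obtained by putting the relation `A^S` between the two levels. -/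
def relOf (S : Set ℕ) : Set ((Cantor × Bool) × (Cantor × Bool)) :=
  {p | p.1 = p.2 ∨ (p.1.2 = false ∧ p.2.2 = true ∧ (p.1.1, p.2.1) ∈ ASet S)}

/-- The pairs `((x, 0), (x, 1))`. -/
def vertical : Set ((Cantor × Bool) × (Cantor × Bool)) :=
  {p | p.1.2 = false ∧ p.2.2 = true ∧ p.1.1 = p.2.1}

lemma relOf_refl (S : Set ℕ) (z : Cantor × Bool) : (z, z) ∈ relOf S := Or.inl rfl

lemma relOf_antisymm {S : Set ℕ} {z w : Cantor × Bool} (h : (z, w) ∈ relOf S)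
    (h' : (w, z) ∈ relOf S) : z = w := by
  rcases h with h | ⟨h, -⟩
  · exact h
  · rcases h' with h' | ⟨-, h', -⟩
    · exact h'.symm
    · exact absurd (h.symm.trans h') (by simp)

lemma relOf_trans {S : Set ℕ} {z w x : Cantor × Bool} (h : (z, w) ∈ relOf S)
    (h' : (w, x) ∈ relOf S) : (z, x) ∈ relOf S := by
  rcases h with h | ⟨h0, h, hzw⟩
  · obtain rfl : z = w := h
    exact h'
  · rcases h' with h' | ⟨h', -⟩
    · obtain rfl : w = x := h'
      exact Or.inr ⟨h0, h, hzw⟩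
    · exact absurd (h'.symm.trans h) (by simp)

lemma mem_ASet_or_eq {S : Set ℕ} {x y : Cantor} :
    (x, y) ∈ ASet S ∨ x = y ↔ ∀ n, x n = y n ∨ (x n = false ∧ cardOnes x n ∈ S ∧
      ∀ m, m = n ∨ x m = y m) := by
  constructor
  · rintro (h | rfl) n
    · obtain ⟨k, hk, hkS, rfl⟩ := mem_ASet.1 h
      by_cases hn : n = k
      · subst hn
        exact Or.inr ⟨hk, hkS, fun m => or_iff_not_imp_left.2 fun hm => (fSfun_of_ne hm x).symm⟩
      · exact Or.inl (fSfun_of_ne hn x).symm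
    · exact Or.inl rfl
  · intro h
    by_cases hxy : x = y
    · exact Or.inr hxy
    · obtain ⟨n, hn⟩ := Function.ne_iff.1 hxy
      obtain ⟨h1, h2, h3⟩ := (h n).resolve_left hn
      refine Or.inl (mem_ASet.2 ⟨n, h1, h2, funext fun m => ?_⟩)
      by_cases hm : m = n
      · subst hm
        rw [h1] at hn
        rw [fSfun_self]
        exact Bool.eq_true_of_not_eq_false (Ne.symm hn)
      · rw [fSfun_of_ne hm, (h3 m).resolve_left hm]

lemma isClosed_ASet_or_eq (S : Set ℕ) :
    IsClosed {p : Cantor × Cantor | p ∈ ASet S ∨ p.1 = p.2} := by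
  have : {p : Cantor × Cantor | p ∈ ASet S ∨ p.1 = p.2} = ⋂ n, ({p | p.1 n = p.2 n} ∪
      ({p | p.1 n = false} ∩ {p | cardOnes p.1 n ∈ S} ∩ ⋂ m, ({p | m = n} ∪ {p | p.1 m = p.2 m})))
      := by
    ext ⟨x, y⟩
    refine mem_ASet_or_eq.trans ?_
    simp only [mem_iInter, mem_union, mem_inter_iff, mem_ofPred_eq, and_assoc]
  rw [this]
  have heq : ∀ n, IsClosed {p : Cantor × Cantor | p.1 n = p.2 n} := fun n =>
    isClosed_eq ((continuous_apply n).comp continuous_fst) ((continuous_apply n).comp continuous_snd)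
  refine isClosed_iInter fun n => (heq n).union (IsClosed.inter (IsClosed.inter ?_ ?_)
    (isClosed_iInter fun m => isClosed_const.union (heq m)))
  · exact (isClopen_apply_eq n false).1.preimage continuous_fst
  · exact (isClopen_cardOnes_mem n S).1.preimage continuous_fst

lemma isClosed_levels : IsClosed
    {p : (Cantor × Bool) × (Cantor × Bool) | p.1.2 = false ∧ p.2.2 = true} :=
  (isClosed_eq (continuous_snd.comp continuous_fst) continuous_const).inter
    (isClosed_eq (continuous_snd.comp continuous_snd) continuous_const)

lemma continuous_bases : Continuous
    fun p : (Cantor × Bool) × (Cantor × Bool) => (p.1.1, p.2.1) :=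
  (continuous_fst.comp continuous_fst).prodMk (continuous_fst.comp continuous_snd)

lemma isClosed_vertical : IsClosed vertical := by
  have : vertical = {p | p.1.2 = false ∧ p.2.2 = true} ∩
      (fun p => (p.1.1, p.2.1)) ⁻¹' diagonal Cantor := by
    ext p
    simp [vertical, and_assoc]
  rw [this]
  exact isClosed_levels.inter (isClosed_diagonal.preimage continuous_bases)

lemma isClosed_relOf_union_vertical (S : Set ℕ) : IsClosed (relOf S ∪ vertical) := by
  have : relOf S ∪ vertical = diagonal _ ∪ ({p | p.1.2 = false ∧ p.2.2 = true} ∩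
      (fun p => (p.1.1, p.2.1)) ⁻¹' {p : Cantor × Cantor | p ∈ ASet S ∨ p.1 = p.2}) := by
    ext p
    simp only [relOf, vertical, mem_union, mem_ofPred_eq, mem_diagonal_iff, mem_inter_iff,
      mem_preimage]
    tauto
  rw [this]
  exact isClosed_diagonal.union
    (isClosed_levels.inter ((isClosed_ASet_or_eq S).preimage continuous_bases))

lemma notMem_ASet_self (S : Set ℕ) (x : Cantor) : (x, x) ∉ ASet S := fun h => by
  obtain ⟨n, hn, -, hx⟩ := mem_ASet.1 h
  rw [hx, fSfun_self] at hn
  cases hn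

lemma disjoint_relOf_vertical (S : Set ℕ) : Disjoint (relOf S) vertical := by
  rw [disjoint_left]
  rintro ⟨⟨x, a⟩, y, b⟩ h ⟨ha, hb, hxy⟩
  obtain rfl : a = false := ha
  obtain rfl : b = true := hb
  obtain rfl : x = y := hxy
  rcases h with h | ⟨-, -, h⟩
  · simp at h
  · exact notMem_ASet_self S x h

lemma d2Sigma01_relOf (S : Set ℕ) : D2Sigma01 inferInstance (relOf S) := by
  refine ⟨verticalᶜ, (relOf S ∪ vertical)ᶜ, isClosed_vertical.isOpen_compl,
    (isClosed_relOf_union_vertical S).isOpen_compl, ?_⟩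
  rw [compl_sdiff_compl, union_sdiff_right, (disjoint_relOf_vertical S).sdiff_eq_left]

lemma mem_relOf_levels {S : Set ℕ} {x y : Cantor} :
    ((x, false), (y, true)) ∈ relOf S ↔ (x, y) ∈ ASet S := by
  simp [relOf]

lemma Syndetic.mono {T T' : Set ℕ} (h : Syndetic T) (hT : T ⊆ T') : Syndetic T' := by
  obtain ⟨k, hk⟩ := h
  exact ⟨k, fun q => (hk q).imp fun _ hc => ⟨hT hc.1, hc.2⟩⟩

lemma syndetic_of_patternSet {S : Set ℕ} (h0 : 0 ∈ S) (hS : Syndetic (patternSet S 0)) :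
    Syndetic S :=
  hS.mono fun _ hc => (hc 0 le_rfl).2 h0

/-- If a Borel map sends `relOf S` into the complement of a countable union of Borel rectangles,
then it sends only few vertical pairs into that union. -/
lemma SigmaIndep.of_isRectUnion {S : Set ℕ} (hS : Syndetic S) {Z : Type*} [MeasurableSpace Z]
    {u : Cantor × Bool → Z} (hu : Measurable u) {A : Set (Z × Z)} (hA : IsRectUnion A)
    (h : ∀ p ∈ relOf S, (u p.1, u p.2) ∉ A) :
    SigmaIndep {x | (u (x, false), u (x, true)) ∈ A} := by
  obtain ⟨𝓡, h1, h2, h3⟩ := hA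
  have := h1.to_subtype
  refine (SigmaIndep.iUnion (C := fun p : 𝓡 => {x | u (x, false) ∈ p.1.1 ∧ u (x, true) ∈ p.1.2})
    fun p => SigmaIndep.of_noLink hS (MeasurableSet.analyticSet ?_) ?_).mono ?_
  · exact ((hu.comp measurable_prodMk_right) (h2 p p.2).1).inter
      ((hu.comp measurable_prodMk_right) (h2 p p.2).2)
  · intro x hx n hn hnS hxn
    exact h ((x, false), (fSfun n x, true)) (mem_relOf_levels.2 (mem_ASet.2 ⟨n, hn, hnS, rfl⟩))
      ((h3 _).2 ⟨p, p.2, hx.1, hxn.2⟩)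
  · intro x hx
    obtain ⟨p, hp, hxp⟩ := (h3 _).1 hx
    exact mem_iUnion.2 ⟨⟨p, hp⟩, hxp⟩

lemma mem_relOf_putOnes {S : Set ℕ} {N : ℕ → ℕ} (hN : StrictMono N) {γ : Cantor}
    (hγ : ∀ j, γ (N j) = false) (hS : ∀ k, cardOnes γ (N k) ∈ patternSet S k)
    (p : (Cantor × Bool) × (Cantor × Bool)) :
    ((putOnes N γ p.1.1, p.1.2), (putOnes N γ p.2.1, p.2.2)) ∈ relOf S ↔ p ∈ relOf S := by
  have hinj : Function.Injective (putOnes N γ) := fun x y hxy => funext fun j => by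
    rw [← putOnes_apply hN.injective hγ x j, hxy, putOnes_apply hN.injective hγ]
  obtain ⟨⟨x, a⟩, y, b⟩ := p
  simp [relOf, hinj.eq_iff, mem_ASet_putOnes hN hγ hS]

lemma not_potClosed_relOf {S : Set ℕ} (hS : Syndetic S) : ¬ PotClosed inferInstance inferInstance
    (relOf S) := by
  intro h
  rw [potClosed_iff] at h
  refine not_sigmaIndep_univ ((SigmaIndep.of_isRectUnion hS measurable_id h fun p hp hp' =>
    hp' hp).mono fun x _ hx => ?_)
  exact notMem_ASet_self S x (mem_relOf_levels.1 hx)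

lemma potClosed_preimage_relOf {S : Set ℕ} {Z : Type} [tZ : TopologicalSpace Z] [PolishSpace Z]
    [MeasurableSpace Z] [BorelSpace Z] {u : Z → Cantor × Bool} (hu : Measurable u)
    (hC : SigmaIndep {x | ∀ ε, ∃ z, u z = (x, ε)}) :
    PotClosed tZ tZ ((fun p : Z × Z => (u p.1, u p.2)) ⁻¹' relOf S) := by
  rw [potClosed_iff]
  obtain ⟨𝓑, h1, h2, h3⟩ := hC
  have hV : IsRectUnion {p : (Cantor × Bool) × (Cantor × Bool) |
      ∃ B ∈ 𝓑, p.1 ∈ B ×ˢ {false} ∧ p.2 ∈ B ×ˢ {true}} := by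
    refine ⟨(fun B => (B ×ˢ {false}, B ×ˢ {true})) '' 𝓑, h1.image _, ?_, fun z => ?_⟩
    · rintro _ ⟨B, hB, rfl⟩
      exact ⟨(h2 B hB).1.prod (measurableSet_singleton _),
        (h2 B hB).1.prod (measurableSet_singleton _)⟩
    · simp only [mem_ofPred_eq, exists_mem_image]
  have heq : ((fun p : Z × Z => (u p.1, u p.2)) ⁻¹' relOf S)ᶜ =
      (fun p : Z × Z => (u p.1, u p.2)) ⁻¹' ((relOf S ∪ vertical)ᶜ ∪
        {p | ∃ B ∈ 𝓑, p.1 ∈ B ×ˢ {false} ∧ p.2 ∈ B ×ˢ {true}}) := by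
    ext ⟨z, w⟩
    constructor
    · intro hzw
      by_cases hv : (u z, u w) ∈ vertical
      · obtain ⟨hz, hw, hx⟩ := hv
        obtain ⟨B, hB, hxB⟩ := h3 (Bool.rec ⟨z, Prod.ext rfl hz⟩ ⟨w, Prod.ext hx.symm hw⟩ :
          ∀ ε, ∃ z', u z' = ((u z).1, ε))
        exact Or.inr ⟨B, hB, ⟨hxB, hz⟩, ⟨by rwa [← show (u z).1 = (u w).1 from hx], hw⟩⟩
      · exact Or.inl fun h => h.elim hzw hv
    · rintro (h | ⟨B, hB, ⟨hz, hz'⟩, hw, hw'⟩) hzw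
      · exact h (Or.inl hzw)
      · rcases hzw with hzw | ⟨-, -, hzw⟩
        · have : u z = u w := hzw
          have hz1 : (u z).2 = false := hz'
          have hw1 : (u w).2 = true := hw'
          simp [this, hw1] at hz1
        · obtain ⟨n, hn, -, hx⟩ := mem_ASet.1 hzw
          exact (h2 B hB).2 _ hz n hn trivial (hx ▸ hw)
  rw [heq]
  exact ((isClosed_relOf_union_vertical S).isOpen_compl.isRectUnion.union hV).preimage hu

lemma minBNonPotClosed_relOf {S : Set ℕ} (h0 : 0 ∈ S) (hS : ∀ p, Syndetic (patternSet S p)) :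
    MinBNonPotClosed inferInstance (relOf S) := by
  refine ⟨not_potClosed_relOf (syndetic_of_patternSet h0 (hS 0)), ?_⟩
  rintro Z tZ hZ A - hA ⟨u, hu, rfl⟩
  borelize Z
  rw [← BorelSpace.measurable_eq (α := Cantor × Bool)] at hu
  obtain ⟨N, γ, h, hN, hγ, hp, hh, huh⟩ := exists_measurable_fusion hS hu fun hC =>
    hA (potClosed_preimage_relOf hu hC)
  refine ⟨h, by rwa [← BorelSpace.measurable_eq (α := Cantor × Bool)], ?_⟩
  ext ⟨⟨x, a⟩, y, b⟩
  simpa only [mem_preimage, huh] using (mem_relOf_putOnes hN hγ hp ((x, a), (y, b))).symm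

lemma mem_ASet_fSfun {S : Set ℕ} {x : Cantor} {n : ℕ} (hx : x n = false) :
    (x, fSfun n x) ∈ ASet S ↔ cardOnes x n ∈ S := by
  rw [mem_ASet]
  refine ⟨fun ⟨m, hm, hmS, h⟩ => ?_, fun h => ⟨n, hx, h, rfl⟩⟩
  obtain rfl : n = m := by
    by_contra hnm
    have := congrFun h n
    rw [fSfun_self, fSfun_of_ne hnm, hx] at this
    cases this
  exact hmS

/-- The characteristic function of a finite set. -/
def ones (F : Finset ℕ) : Cantor := fun i => decide (i ∈ F)

lemma fSfun_ones (n : ℕ) (F : Finset ℕ) : fSfun n (ones F) = ones (insert n F) := by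
  funext i
  by_cases hi : i = n
  · subst hi
    simp [ones]
  · simp [ones, fSfun_of_ne hi, hi]

lemma ones_of_notMem {n : ℕ} {F : Finset ℕ} (h : n ∉ F) : ones F n = false := by simp [ones, h]

lemma ones_injective : Function.Injective ones := fun F G h => by
  ext i
  simpa [ones] using congrFun h i

lemma cardOnes_ones_of_forall_le {n : ℕ} {F : Finset ℕ} (h : ∀ i ∈ F, n ≤ i) :
    cardOnes (ones F) n = 0 :=
  Finset.sum_eq_zero fun i hi => by
    rw [ones_of_notMem fun hF => (Finset.mem_range.1 hi).not_ge (h i hF)]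
    rfl

lemma cardOnes_ones_range {j p : ℕ} (h : j ≤ p) : cardOnes (ones (Finset.range j)) p = j := by
  have : ((Finset.range p).filter fun i => ones (Finset.range j) i = true) = Finset.range j := by
    ext i
    simp only [ones, Finset.mem_filter, Finset.mem_range, decide_eq_true_eq]
    omega
  rw [cardOnes_eq_card, this, Finset.card_range]

lemma putOnes_comp (N M : ℕ → ℕ) (γ x : Cantor) :
    putOnes N γ (putOnes M (fun _ => false) x) = putOnes (N ∘ M) γ x := by
  funext i
  rw [Bool.eq_iff_iff]
  simp only [putOnes_eq_true, Function.comp_apply, Bool.false_eq_true, false_or]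
  refine or_congr_right ⟨?_, ?_⟩
  · rintro ⟨_, rfl, j, rfl, hj⟩
    exact ⟨j, rfl, hj⟩
  · rintro ⟨j, rfl, hj⟩
    exact ⟨_, rfl, j, rfl, hj⟩

lemma putOnes_ones_range (g : ℕ → ℕ) (j : ℕ) :
    putOnes g (fun _ => false) (ones (Finset.range j)) = ones ((Finset.range j).image g) := by
  funext i
  rw [Bool.eq_iff_iff, putOnes_eq_true]
  simp [ones, and_comm]

lemma exists_eq_putOnes {S S' : Set ℕ} (h0 : 0 ∈ S) (h1 : 1 ∈ S) {w : Cantor → Cantor}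
    (hw : w.Injective) (h : ∀ x y, (x, y) ∈ ASet S → (w x, w y) ∈ ASet S') :
    ∃ (π : ℕ → ℕ) (γ : Cantor), π.Injective ∧ (∀ n, γ (π n) = false) ∧
      ∀ F, w (ones F) = putOnes π γ (ones F) := by
  have hlink : ∀ n F, n ∉ F → cardOnes (ones F) n ∈ S →
      ∃ a, w (ones F) a = false ∧ w (ones (insert n F)) = fSfun a (w (ones F)) := by
    intro n F hn hF
    obtain ⟨a, ha, -, hw⟩ := mem_ASet.1 (h _ _ ((mem_ASet_fSfun (ones_of_notMem hn)).2 hF))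
    exact ⟨a, ha, by rw [← hw, fSfun_ones]⟩
  choose π hπ hwπ using fun n => hlink n ∅ (by simp) (by
    rw [cardOnes_ones_of_forall_le (by simp)]; exact h0)
  have hπi : π.Injective := fun n m hnm => by
    have := ones_injective (hw ((hwπ n).trans ((hnm ▸ rfl : _ = _).trans (hwπ m).symm)))
    simpa using this
  refine ⟨π, w (ones ∅), hπi, hπ, fun F => ?_⟩
  induction hk : F.card using Nat.strong_induction_on generalizing F with
  | _ k ih =>
  rcases F.eq_empty_or_nonempty with rfl | hF
  · funext i
    rw [Bool.eq_iff_iff, putOnes_eq_true]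
    simp [ones]
  obtain ⟨n₁, F₁, hF₁, rfl, hlt₁⟩ : ∃ n F', n ∉ F' ∧ F = insert n F' ∧ ∀ i ∈ F', n < i :=
    ⟨F.min' hF, F.erase (F.min' hF), by simp, (Finset.insert_erase (F.min'_mem hF)).symm,
      fun i hi => F.min'_lt_of_mem_erase_min' hF hi⟩
  rcases F₁.eq_empty_or_nonempty with rfl | hF
  · rw [hwπ, ← fSfun_ones, putOnes_fSfun, ← ih 0 (by simp [← hk]) ∅ rfl]
  obtain ⟨n₂, Y, hY, rfl, hlt₂⟩ : ∃ n F', n ∉ F' ∧ F₁ = insert n F' ∧ ∀ i ∈ F', n < i :=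
    ⟨F₁.min' hF, F₁.erase (F₁.min' hF), by simp, (Finset.insert_erase (F₁.min'_mem hF)).symm,
      fun i hi => F₁.min'_lt_of_mem_erase_min' hF hi⟩
  have hn : n₁ < n₂ := hlt₁ n₂ (by simp)
  have hn₁ : n₁ ∉ Y := fun hn => hF₁ (by simp [hn])
  simp only [Finset.card_insert_of_notMem hF₁, Finset.card_insert_of_notMem hY] at hk
  have e₁ := ih _ (by rw [Finset.card_insert_of_notMem hn₁]; omega) (insert n₁ Y) rfl
  have e₂ := ih _ (by rw [Finset.card_insert_of_notMem hY]; omega) (insert n₂ Y) rfl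
  obtain ⟨a, -, hwa⟩ := hlink n₂ (insert n₁ Y) (by simp [hY, hn.ne']) (by
    rw [← fSfun_ones, cardOnes_fSfun_of_lt hn (ones_of_notMem hn₁),
      cardOnes_ones_of_forall_le fun i hi => (hlt₂ i hi).le]
    exact h1)
  obtain ⟨b, -, hwb⟩ := hlink n₁ (insert n₂ Y) hF₁ (by
    rw [cardOnes_ones_of_forall_le fun i hi => (hlt₁ i hi).le]
    exact h0)
  rw [Finset.insert_comm, hwb, e₂, e₁, ← fSfun_ones, ← fSfun_ones, putOnes_fSfun,
    putOnes_fSfun] at hwa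
  obtain rfl : π n₂ = a := by
    by_contra hne
    have := congrFun hwa (π n₂)
    rw [fSfun_of_ne hne, fSfun_of_ne (hπi.ne hn.ne'), putOnes_apply hπi hπ, ones_of_notMem hY]
      at this
    by_cases hb : π n₂ = b
    · rw [← hb, fSfun_self] at this
      cases this
    · rw [fSfun_of_ne hb, fSfun_self] at this
      cases this
  rw [hwb, e₂, ← fSfun_ones n₂, putOnes_fSfun, hwa, ← fSfun_ones, ← fSfun_ones, putOnes_fSfun,
    putOnes_fSfun, fSfun_comm]

lemma exists_shift {S S' : Set ℕ} (h0 : 0 ∈ S) (h1 : 1 ∈ S) {w : Cantor → Cantor}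
    (hw : w.Injective) (h : ∀ x y, (x, y) ∈ ASet S ↔ (w x, w y) ∈ ASet S') (p : ℕ) :
    ∃ c, ∀ j ≤ p, c + j ∈ S' ↔ j ∈ S := by
  obtain ⟨π, γ, hπ, hγ, hwπ⟩ := exists_eq_putOnes h0 h1 hw fun x y => (h x y).1
  obtain ⟨g, hg, hπg⟩ := strictMono_subseq_of_tendsto_atTop hπ.nat_tendsto_atTop
  refine ⟨cardOnes γ (π (g p)), fun j hj => ?_⟩
  have hγg : ∀ k, γ ((π ∘ g) k) = false := fun k => hγ (g k)
  have hp : ones (Finset.range j) p = false := ones_of_notMem (by simpa using hj)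
  set x := putOnes g (fun _ => false) (ones (Finset.range j)) with hx
  have hxp : x (g p) = false := by rw [hx, putOnes_apply hg.injective (fun _ => rfl), hp]
  have hwx : w x = putOnes (π ∘ g) γ (ones (Finset.range j)) := by
    rw [hx, putOnes_ones_range, hwπ, ← putOnes_ones_range, putOnes_comp]
  have hwx' : w (fSfun (g p) x) = fSfun (π (g p)) (w x) := by
    rw [hwx, hx, putOnes_ones_range, fSfun_ones, hwπ, ← fSfun_ones, putOnes_fSfun,
      ← putOnes_ones_range, putOnes_comp]
  have hwxp : w x (π (g p)) = false := by
    rw [hwx, ← hp]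
    exact putOnes_apply hπg.injective hγg _ p
  have h1 := h x (fSfun (g p) x)
  have e1 : cardOnes x (g p) = j := by
    rw [hx, cardOnes_putOnes hg (fun _ => rfl), cardOnes_ones_range hj]
    simp [cardOnes]
  have e2 : cardOnes (w x) (π (g p)) = cardOnes γ (π (g p)) + j := by
    rw [hwx]
    exact (cardOnes_putOnes hπg hγg _ p).trans (by rw [cardOnes_ones_range hj]; rfl)
  rw [hwx', mem_ASet_fSfun hxp, mem_ASet_fSfun hwxp, e1, e2] at h1
  exact h1.symm

lemma exists_putOnes_mem {S : Set ℕ} (hS : ∀ p, Syndetic (patternSet S p)) {G : Set Cantor}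
    (hG : MeasurableSet G) (h : ¬ SigmaIndep G) :
    ∃ (N : ℕ → ℕ) (γ : Cantor), StrictMono N ∧ (∀ j, γ (N j) = false) ∧
      (∀ k, cardOnes γ (N k) ∈ patternSet S k) ∧ ∀ x, putOnes N γ x ∈ G := by
  classical
  let u : Cantor × Bool → Cantor × Bool := fun z => if z.1 ∈ G then z else (z.1, false)
  have hu : Measurable u := Measurable.ite (measurable_fst hG) measurable_id
    (measurable_fst.prodMk measurable_const)
  obtain ⟨N, γ, f, hN, hγ, hp, -, hf⟩ := exists_measurable_fusion hS hu fun hC =>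
    h (hC.mono fun x hx ε => ⟨(x, ε), if_pos hx⟩)
  refine ⟨N, γ, hN, hγ, hp, fun x => ?_⟩
  have := hf x true
  by_cases hx : (f (x, true)).1 ∈ G
  · simp only [u, if_pos hx] at this
    rwa [this] at hx
  · simp only [u, if_neg hx] at this
    simp at this

theorem exists_shift_of_redB {S S' : Set ℕ} (h0 : 0 ∈ S) (h1 : 1 ∈ S)
    (hS : ∀ p, Syndetic (patternSet S p))
    (h : RedB inferInstance inferInstance (relOf S) (relOf S')) (p : ℕ) :
    ∃ c, ∀ j ≤ p, c + j ∈ S' ↔ j ∈ S := by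
  obtain ⟨u, hu, hred⟩ := h
  rw [← BorelSpace.measurable_eq (α := Cantor × Bool)] at hu
  replace hred : ∀ z w, (z, w) ∈ relOf S ↔ (u z, u w) ∈ relOf S' := fun z w => by
    conv_lhs => rw [hred]
    rfl
  have hpair : Measurable fun x => (u (x, false), u (x, true)) :=
    (hu.comp measurable_prodMk_right).prodMk (hu.comp measurable_prodMk_right)
  obtain ⟨N, γ, hN, hγ, hp, hG⟩ := exists_putOnes_mem hS
      (hpair isClosed_vertical.measurableSet) fun hG => by
    refine not_sigmaIndep_univ ((hG.union (SigmaIndep.of_isRectUnion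
      (syndetic_of_patternSet h0 (hS 0)) hu
      (isClosed_relOf_union_vertical S').isOpen_compl.isRectUnion
      fun q hq hq' => hq' (Or.inl ((hred _ _).1 hq)))).mono fun x _ => ?_)
    by_cases hx : (u (x, false), u (x, true)) ∈ vertical
    · exact Or.inl hx
    · refine Or.inr fun hx' => ?_
      exact notMem_ASet_self S x (mem_relOf_levels.1 ((hred _ _).2 (hx'.resolve_right hx)))
  let w : Cantor → Cantor := fun x => (u (putOnes N γ x, false)).1
  have hw : ∀ x ε, u (putOnes N γ x, ε) = (w x, ε) := by
    intro x ε
    obtain ⟨ha, hb, hab⟩ := hG x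
    cases ε
    · exact Prod.ext rfl ha
    · exact Prod.ext hab.symm hb
  have key : ∀ x y a b, ((x, a), (y, b)) ∈ relOf S ↔ ((w x, a), (w y, b)) ∈ relOf S' := by
    intro x y a b
    rw [← hw, ← hw, ← hred]
    exact (mem_relOf_putOnes hN hγ hp ((x, a), (y, b))).symm
  refine exists_shift h0 h1 (w := w) (fun x y hxy => ?_) (fun x y => ?_) p
  · have := (key x y false false).2 (Or.inl (by rw [hxy]))
    simpa [relOf] using this
  · rw [← mem_relOf_levels, key, mem_relOf_levels]

/-- A sequence coding `α` whose tails take both values within any three consecutive places. -/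
def codeSeq (α : Cantor) (i : ℕ) : Bool :=
  if i = 0 ∨ i % 3 = 1 then true else if i % 3 = 2 then α (i / 3) else false

lemma codeSeq_three_mul (α : Cantor) (i : ℕ) : codeSeq α (3 * i + 2) = α i := by
  have h1 : ¬ (3 * i + 2 = 0 ∨ (3 * i + 2) % 3 = 1) := by omega
  have h2 : (3 * i + 2) % 3 = 2 := by omega
  have h3 : (3 * i + 2) / 3 = i := by omega
  rw [codeSeq, if_neg h1, if_pos h2, h3]

/-- The set of the `j` such that `codeSeq α` is true at the dyadic valuation of `j + 1`. -/
def codeSet (α : Cantor) : Set ℕ := {j | codeSeq α (padicValNat 2 (j + 1)) = true}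

lemma padicValNat_two_pow_mul_odd (k m : ℕ) : padicValNat 2 (2 ^ k * (2 * m + 1)) = k := by
  rw [padicValNat.mul (by positivity) (by omega), padicValNat.prime_pow,
    padicValNat.eq_zero_of_not_dvd (by omega), add_zero]

lemma padicValNat_two_pow_mul_add {M a b : ℕ} (hb : b ≠ 0) (hbM : b < 2 ^ M) :
    padicValNat 2 (2 ^ M * a + b) = padicValNat 2 b := by
  obtain ⟨k, _, ⟨m, rfl⟩, rfl⟩ := Nat.exists_eq_two_pow_mul_odd hb
  have hk : k < M := (Nat.pow_lt_pow_iff_right (by norm_num : 1 < 2)).1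
    ((Nat.le_mul_of_pos_right _ (by omega)).trans_lt hbM)
  obtain ⟨d, rfl⟩ := Nat.exists_eq_add_of_lt hk
  have : 2 ^ (k + d + 1) * a + 2 ^ k * (2 * m + 1) = 2 ^ k * (2 * (2 ^ d * a + m) + 1) := by ring
  rw [this, padicValNat_two_pow_mul_odd, padicValNat_two_pow_mul_odd]

lemma zero_mem_codeSet (α : Cantor) : 0 ∈ codeSet α := by
  change codeSeq α (padicValNat 2 1) = true
  simp [codeSeq]

lemma one_mem_codeSet (α : Cantor) : 1 ∈ codeSet α := by
  change codeSeq α (padicValNat 2 2) = true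
  rw [padicValNat_self]
  rfl

lemma syndetic_patternSet_codeSet (α : Cantor) (p : ℕ) : Syndetic (patternSet (codeSet α) p) := by
  refine ⟨2 ^ (p + 2), fun q => ⟨2 ^ (p + 2) * (q / 2 ^ (p + 2) + 1), fun j hj => ?_, ?_, ?_⟩⟩
  · have : j + 1 < 2 ^ (p + 2) := (Nat.lt_two_pow_self).trans_le
      (Nat.pow_le_pow_right (by norm_num) (by omega))
    change codeSeq α _ = true ↔ codeSeq α _ = true
    rw [add_assoc, padicValNat_two_pow_mul_add (by omega) this]
  · exact (Nat.lt_mul_div_succ q (by positivity)).le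
  · rw [mul_add, mul_one]
    exact Nat.add_le_add_right (Nat.mul_div_le _ _) _

lemma eq_of_codeSet_shift {α α' : Cantor}
    (h : ∀ p, ∃ c, ∀ j ≤ p, c + j ∈ codeSet α' ↔ j ∈ codeSet α) : α = α' := by
  have hcode : ∀ i, codeSeq α i = codeSeq α' i := by
    intro i
    obtain ⟨c, hc⟩ := h (2 ^ (i + 4))
    replace hc : ∀ j, 0 < j → j ≤ 2 ^ (i + 4) →
        codeSeq α' (padicValNat 2 (c + j)) = codeSeq α (padicValNat 2 j) := by
      intro j hj hji
      obtain ⟨j, rfl⟩ := Nat.exists_eq_succ_of_ne_zero hj.ne'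
      exact Bool.eq_iff_iff.2 (hc j (by omega))
    have key : ∀ k ≤ i + 1, 2 ^ k ∣ c ∧ ∀ l < k, codeSeq α l = codeSeq α' l := by
      intro k hk
      induction k with
      | zero => simp
      | succ k ih =>
        obtain ⟨⟨d, rfl⟩, hl⟩ := ih (by omega)
        have hle : ∀ t ≤ 4, 2 ^ (k + t) ≤ 2 ^ (i + 4) := fun t ht =>
          Nat.pow_le_pow_right (by norm_num) (by omega)
        obtain ⟨m, rfl | rfl⟩ := Nat.even_or_odd' d
        · have h0 := hc (2 ^ k) (by positivity) (hle 0 (by norm_num))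
          rw [show 2 ^ k * (2 * m) + 2 ^ k = 2 ^ k * (2 * m + 1) by ring,
            padicValNat_two_pow_mul_odd, padicValNat.prime_pow] at h0
          refine ⟨⟨m, by ring⟩, fun l hlk => ?_⟩
          rcases Nat.lt_succ_iff_lt_or_eq.1 hlk with hlk | rfl
          · exact hl l hlk
          · exact h0.symm
        · exfalso
          have ht : ∀ t < 4, codeSeq α (k + (t + 1)) = codeSeq α' k := by
            intro t ht
            have := hc (2 ^ (k + (t + 1))) (by positivity) (hle _ (by omega))
            rw [show 2 ^ k * (2 * m + 1) + 2 ^ (k + (t + 1)) = 2 ^ k * (2 * (m + 2 ^ t) + 1) by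
              ring, padicValNat_two_pow_mul_odd, padicValNat.prime_pow] at this
            exact this.symm
          obtain ⟨t, ht4, htk⟩ : ∃ t < 3, (k + (t + 1)) % 3 = 0 :=
            ⟨2 - k % 3, by omega, by omega⟩
          have h0 : codeSeq α (k + (t + 1)) = false := by
            rw [codeSeq, if_neg (by omega), if_neg (by omega)]
          obtain ⟨t', ht4', htk'⟩ : ∃ t < 3, (k + (t + 1)) % 3 = 1 :=
            ⟨(3 - k % 3) % 3, by omega, by omega⟩
          have h1 : codeSeq α (k + (t' + 1)) = true := if_pos (Or.inr htk')
          rw [ht t (by omega)] at h0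
          rw [ht t' (by omega), h0] at h1
          cases h1
    exact (key (i + 1) le_rfl).2 i (Nat.lt_succ_self i)
  funext i
  rw [← codeSeq_three_mul α, hcode, codeSeq_three_mul]

theorem stmt2 :
    ∃ R : Cantor → Set ((Cantor × Bool) × (Cantor × Bool)),
      (∀ α : Cantor,
        (∀ z, (z, z) ∈ R α) ∧
        (∀ z w, (z, w) ∈ R α → (w, z) ∈ R α → z = w) ∧
        (∀ z w x, (z, w) ∈ R α → (w, x) ∈ R α → (z, x) ∈ R α) ∧
        D2Sigma01 inferInstance (R α) ∧
        MinBNonPotClosed inferInstance (R α)) ∧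
      ∀ α α', α ≠ α' →
        ¬ RedB inferInstance inferInstance (R α) (R α') ∧
        ¬ RedB inferInstance inferInstance (R α') (R α) := by
  have hred : ∀ α α', RedB inferInstance inferInstance (relOf (codeSet α)) (relOf (codeSet α')) →
      α = α' := fun α α' h => eq_of_codeSet_shift (exists_shift_of_redB (zero_mem_codeSet α)
    (one_mem_codeSet α) (syndetic_patternSet_codeSet α) h)
  exact ⟨fun α => relOf (codeSet α), fun α => ⟨relOf_refl _, fun _ _ => relOf_antisymm,
    fun _ _ _ => relOf_trans, d2Sigma01_relOf _,
    minBNonPotClosed_relOf (zero_mem_codeSet α) (syndetic_patternSet_codeSet α)⟩,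
    fun α α' hne => ⟨fun h => hne (hred _ _ h), fun h => hne (hred _ _ h).symm⟩⟩
end

section
/- Let X be a nonempty Polish space and, for each n ∈ ω, let f_n : D_{f_n} → f_n[D_{f_n}] be a continuous open map, where D_{f_n} and f_n[D_{f_n}] are dense G_δ subsets of some open subsets of X. Set A := ⋃_n Graph(f_n). If Δ(X) ⊆ closure(A) ∖ A, then A is not pot(Π⁰₁). -/
open Set Topology

/-- A `Gδ` set which is dense in some open set containing it is a Baire space. -/
theorem IsGδ.baireSpace_of_subset_open {X : Type*} [TopologicalSpace X] [BaireSpace X]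
    {D U : Set X} (hD : IsGδ D) (hU : IsOpen U) (hDU : D ⊆ U) (hUD : U ⊆ closure D) :
    BaireSpace D := by
  have hE : IsGδ (D ∪ (closure D)ᶜ) := hD.union isClosed_closure.isOpen_compl.isGδ
  have hdense : Dense (D ∪ (closure D)ᶜ) := by
    intro x
    by_cases hx : x ∈ closure D
    · exact closure_mono subset_union_left hx
    · exact subset_closure (Or.inr hx)
  have := hE.baireSpace_of_dense hdense
  refine Topology.IsOpenEmbedding.baireSpace
    (p := inclusion (subset_union_left : D ⊆ D ∪ (closure D)ᶜ)) ⟨IsEmbedding.inclusion _, ?_⟩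
  rw [range_inclusion]
  convert hU.preimage (continuous_subtype_val (p := (· ∈ D ∪ (closure D)ᶜ))) using 1
  ext ⟨x, hx⟩
  exact ⟨fun h => hDU h, fun h => hx.resolve_right fun h' => h' (hUD h)⟩

theorem tendsto_residual_of_dense_preimage {α β : Type*} [TopologicalSpace α]
    [TopologicalSpace β] {φ : α → β} (hc : Continuous φ)
    (hd : ∀ O : Set β, IsOpen O → Dense O → Dense (φ ⁻¹' O)) :
    Filter.Tendsto φ (residual α) (residual β) := by
  intro s hs
  obtain ⟨S, hSo, hSd, hSc, hSs⟩ := mem_residual_iff.1 hs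
  refine mem_residual_iff.2 ⟨preimage φ '' S, ?_, ?_, hSc.image _, ?_⟩
  · rintro _ ⟨t, ht, rfl⟩
    exact (hSo t ht).preimage hc
  · rintro _ ⟨t, ht, rfl⟩
    exact hd t (hSo t ht) (hSd t ht)
  · intro x hx
    exact hSs fun t ht => hx _ ⟨t, ht, rfl⟩

/-- Comeager sets pull back along a continuous map which is open onto its image, provided the
image is dense in some open set containing it. -/
theorem tendsto_residual_of_open_onto_image {X Y : Type*} [TopologicalSpace X]
    [TopologicalSpace Y] {D : Set X} {V : Set Y} {f : X → Y} (hc : ContinuousOn f D)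
    (hV : IsOpen V) (hfV : f '' D ⊆ V) (hVf : V ⊆ closure (f '' D))
    (hopen : ∀ W : Set X, IsOpen W →
      ∃ W' : Set Y, IsOpen W' ∧ f '' (W ∩ D) = W' ∩ (f '' D)) :
    Filter.Tendsto (fun x : D => f x) (residual D) (residual Y) := by
  refine tendsto_residual_of_dense_preimage hc.domRestrict fun O hO hOd => ?_
  rw [dense_iff_inter_open]
  rintro _ ⟨W, hW, rfl⟩ ⟨x, hx⟩
  obtain ⟨W', hW', heq⟩ := hopen W hW
  have hfx : f x ∈ W' ∩ f '' D := heq ▸ mem_image_of_mem f ⟨hx, x.2⟩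
  obtain ⟨y, hyW, hyO⟩ := hOd.inter_open_nonempty _ (hW'.inter hV) ⟨f x, hfx.1, hfV hfx.2⟩
  obtain ⟨z, ⟨⟨hzW, hzO⟩, hzD⟩⟩ :=
    mem_closure_iff.1 (hVf hyW.2) (W' ∩ O) (hW'.inter hO) ⟨hyW.1, hyO⟩
  obtain ⟨w, ⟨hwW, hwD⟩, rfl⟩ := heq.superset ⟨hzW, hzD⟩
  exact ⟨⟨w, hwD⟩, hwW, hzO⟩

/-- A finer Polish topology agrees with the original one on a comeager set. -/
theorem exists_residual_nhds_le_of_finer_polish {X : Type*} (σ : TopologicalSpace X)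
    [tX : TopologicalSpace X] [PolishSpace X] (hle : σ ≤ tX) (hσ : @PolishSpace X σ) :
    ∃ G ∈ residual X, ∀ x ∈ G, ∀ O : Set X, IsOpen[σ] O → x ∈ O →
      ∃ W : Set X, IsOpen W ∧ x ∈ W ∧ W ∩ G ⊆ O := by
  have hborel : @borel X σ = borel X := MeasureTheory.borel_eq_borel_of_le hσ ‹_› hle
  let _ : MeasurableSpace X := borel X
  have : BorelSpace X := ⟨rfl⟩
  obtain ⟨B, hBc, -, hB⟩ :=
    @TopologicalSpace.exists_countable_basis X σ hσ.toSecondCountableTopology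
  have hmeas : ∀ b ∈ B, MeasurableSet b := fun b hb => by
    change @MeasurableSet X (borel X) b
    rw [← hborel]
    exact MeasurableSpace.measurableSet_generateFrom
      (@TopologicalSpace.IsTopologicalBasis.isOpen X σ b B hB hb)
  have hW : ∀ b ∈ B, ∃ W : Set X, IsOpen W ∧ b =ᶠ[residual X] W := fun b hb =>
    (hmeas b hb).residualEq_isOpen
  choose! W hWo hWe using hW
  refine ⟨{x | ∀ b ∈ B, b x = W b x}, (eventually_countable_ball hBc).2 hWe, ?_⟩
  intro x hx O hO hxO
  obtain ⟨b, hb, hxb, hbO⟩ :=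
    @TopologicalSpace.IsTopologicalBasis.exists_subset_of_mem_open X σ B hB x O hxO hO
  refine ⟨W b, hWo b hb, (hx b hb).mp hxb, fun y hy => hbO ?_⟩
  exact (hy.2 b hb).mpr hy.1

theorem stmt4 {X : Type} [tX : TopologicalSpace X] [PolishSpace X] [Nonempty X]
    (D : ℕ → Set X) (f : ℕ → X → X)
    (hreg : ∀ n, ∃ U V : Set X, IsOpen U ∧ IsOpen V ∧
      D n ⊆ U ∧ IsGδ (D n) ∧ U ⊆ closure (D n) ∧
      f n '' D n ⊆ V ∧ IsGδ (f n '' D n) ∧ V ⊆ closure (f n '' D n))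
    (hcont : ∀ n, ContinuousOn (f n) (D n))
    (hopen : ∀ n, ∀ W : Set X, IsOpen W →
      ∃ W' : Set X, IsOpen W' ∧ f n '' (W ∩ D n) = W' ∩ (f n '' D n))
    (hdiag : Set.diagonal X ⊆ closure (unionGraphs D f) \ unionGraphs D f) :
    ¬ PotClosed tX tX (unionGraphs D f) := by
  have key : ∀ G ∈ residual X, ∀ H ∈ residual X, ∃ x ∈ G ∩ H, ∀ W₁ W₂ : Set X,
      IsOpen W₁ → IsOpen W₂ → x ∈ W₁ → x ∈ W₂ →
      ((W₁ ∩ G) ×ˢ (W₂ ∩ H) ∩ unionGraphs D f).Nonempty := by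
    intro G hG H hH
    obtain ⟨x, hx⟩ := (dense_of_mem_residual (Filter.inter_mem hG hH)).nonempty
    refine ⟨x, hx, fun W₁ W₂ hW₁ hW₂ hxW₁ hxW₂ => ?_⟩
    obtain ⟨⟨a, b⟩, ⟨haW, hbW⟩, hab⟩ := mem_closure_iff.1
      (hdiag (show (x, x) ∈ diagonal X from rfl)).1 (W₁ ×ˢ W₂) (hW₁.prod hW₂) ⟨hxW₁, hxW₂⟩
    obtain ⟨n, haD, hb⟩ := mem_iUnion.1 hab
    obtain rfl : b = f n a := hb
    obtain ⟨U, V, hU, hV, hDU, hDG, hUD, hRV, -, hVR⟩ := hreg n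
    have := hDG.baireSpace_of_subset_open hU hDU hUD
    have hid : Filter.Tendsto (fun y : D n => id (y : X)) (residual (D n)) (residual X) :=
      tendsto_residual_of_open_onto_image continuousOn_id hU (by simpa using hDU)
        (by simpa using hUD) fun W hW => ⟨W, hW, by simp⟩
    have hf := tendsto_residual_of_open_onto_image (hcont n) hV hRV hVR (hopen n)
    have hd := dense_of_mem_residual (Filter.inter_mem (hid hG) (hf hH))
    obtain ⟨c, ⟨hcW₁, hcW₂⟩, hcG, hcH⟩ := hd.inter_open_nonempty
      ((Subtype.val : D n → X) ⁻¹' W₁ ∩ (fun y : D n => f n y) ⁻¹' W₂)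
      ((hW₁.preimage continuous_subtype_val).inter (hW₂.preimage (hcont n).domRestrict))
      ⟨⟨a, haD⟩, haW, hbW⟩
    exact ⟨(c, f n c), ⟨⟨hcW₁, hcG⟩, hcW₂, hcH⟩, mem_iUnion.2 ⟨n, c.2, rfl⟩⟩
  rintro ⟨σ, τ, hσ, hτ, hPσ, hPτ, hclosed⟩
  obtain ⟨G, hG, hGnhds⟩ := exists_residual_nhds_le_of_finer_polish (tX := tX) σ hσ hPσ
  obtain ⟨H, hH, hHnhds⟩ := exists_residual_nhds_le_of_finer_polish (tX := tX) τ hτ hPτ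
  obtain ⟨x, ⟨hxG, hxH⟩, hx⟩ := key G hG H hH
  refine (hdiag (show (x, x) ∈ diagonal X from rfl)).2 ?_
  rw [← @IsClosed.closure_eq _ (@instTopologicalSpaceProd X X σ τ) _ hclosed,
    @mem_closure_iff_nhds _ (@instTopologicalSpaceProd X X σ τ)]
  intro t ht
  obtain ⟨O₁, O₂, hO₁, hx₁, hO₂, hx₂, hsub⟩ := (@mem_nhds_prod_iff' X X σ τ _ _ _).1 ht
  obtain ⟨W₁, hW₁, hxW₁, hWO₁⟩ := hGnhds x hxG O₁ hO₁ hx₁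
  obtain ⟨W₂, hW₂, hxW₂, hWO₂⟩ := hHnhds x hxH O₂ hO₂ hx₂
  exact (hx W₁ W₂ hW₁ hW₂ hxW₁ hxW₂).mono
    (inter_subset_inter_left _ ((prod_mono hWO₁ hWO₂).trans hsub))
end

section
/- The set A₁ satisfies closure(A₁) = A₁ ∪ Δ(2^ω), so that A₁ = closure(A₁) ∖ Δ(2^ω); moreover A₁ belongs to D₂(Σ⁰₁) and A₁ is not pot(Π⁰₁). -/
open Set Topology

theorem exists_bits_succ_eq_append_true (l : List Bool) : ∃ n : ℕ, (n + 1).bits = l ++ [true] := by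
  induction l with
  | nil => exact ⟨0, by simp⟩
  | cons b l ih =>
    obtain ⟨m, hm⟩ := ih
    refine ⟨Nat.bit b (m + 1) - 1, ?_⟩
    have hpos : 1 ≤ Nat.bit b (m + 1) := Nat.one_le_iff_ne_zero.2 (by simp)
    rw [Nat.sub_add_cancel hpos, Nat.bits_append_bit _ _ (by simp), hm, List.cons_append]

theorem psiSeq_surjective : Function.Surjective psiSeq := by
  intro l
  obtain ⟨n, hn⟩ := exists_bits_succ_eq_append_true l.reverse
  exact ⟨n, by simp [psiSeq, hn]⟩

theorem length_psiSeq_le (n : ℕ) : (psiSeq n).length ≤ n := by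
  have h : (n + 1).size ≤ n + 1 := Nat.size_le.2 Nat.lt_two_pow_self
  simp only [psiSeq, List.length_reverse, List.length_dropLast, Nat.size_eq_bits_len]
  omega

theorem length_sSeq (n : ℕ) : (sSeq n).length = n := by
  have := length_psiSeq_le n
  simp only [sSeq, List.length_append, List.length_replicate]
  omega

/-- The sequence `s_n` is dense in `2^ω`. -/
theorem exists_sSeqFn_eq (x : Cantor) (N : ℕ) : ∃ n, N ≤ n ∧ ∀ i < N, sSeqFn n i = x i := by
  obtain ⟨n, hn⟩ := psiSeq_surjective (List.ofFn fun i : Fin N => x i)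
  have hlen := length_psiSeq_le n
  rw [hn, List.length_ofFn] at hlen
  refine ⟨n, hlen, fun i hi => ?_⟩
  simp [sSeqFn, sSeq, hn, List.getElem?_append, hi]

theorem catSeq_sSeq_apply_of_lt {n i : ℕ} (h : i < n) (b : Bool) (γ : Cantor) :
    catSeq (sSeq n ++ [b]) γ i = sSeqFn n i := by
  have hlen := length_sSeq n
  have h1 : i < (sSeq n).length := by omega
  have h2 : i < (sSeq n).length + 1 := by omega
  simp [catSeq, sSeqFn, h1, h2]

theorem catSeq_sSeq_apply_self (n : ℕ) (b : Bool) (γ : Cantor) :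
    catSeq (sSeq n ++ [b]) γ n = b := by
  simp [catSeq, length_sSeq]

theorem catSeq_sSeq_apply_of_gt {n i : ℕ} (h : n < i) (b : Bool) (γ : Cantor) :
    catSeq (sSeq n ++ [b]) γ i = γ (i - (n + 1)) := by
  have h1 : ¬ i < n + 1 := by omega
  simp [catSeq, length_sSeq, h1]

theorem A1_eq_unionGraphs :
    A1 = unionGraphs (fun n => step1Dom n true) (fun n => step1Fun n true) := by
  ext ⟨x, y⟩
  simp only [A1, unionGraphs, graphRel, step1Dom, step1Fun, mem_ofPred_eq, mem_iUnion, Bool.not_true]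
  refine exists_congr fun n => ⟨?_, ?_⟩
  · rintro ⟨γ, rfl, rfl⟩
    refine ⟨⟨fun i hi => catSeq_sSeq_apply_of_lt hi _ _, catSeq_sSeq_apply_self n _ _⟩, ?_⟩
    funext i
    rcases lt_trichotomy i n with h | rfl | h
    · simp [h.ne, catSeq_sSeq_apply_of_lt h]
    · simp [catSeq_sSeq_apply_self]
    · simp [h.ne', catSeq_sSeq_apply_of_gt h]
  · rintro ⟨⟨hx, hxn⟩, rfl⟩
    refine ⟨fun k => x (k + (n + 1)), ?_, ?_⟩ <;> funext i <;>
      rcases lt_trichotomy i n with h | rfl | h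
    · rw [catSeq_sSeq_apply_of_lt h, hx i h]
    · rw [catSeq_sSeq_apply_self, hxn]
    · rw [catSeq_sSeq_apply_of_gt h, Nat.sub_add_cancel h]
    · simp [h.ne, catSeq_sSeq_apply_of_lt h, hx i h]
    · simp [catSeq_sSeq_apply_self]
    · simp [h.ne', catSeq_sSeq_apply_of_gt h, Nat.sub_add_cancel h]

theorem mem_A1_iff {x y : Cantor} :
    (x, y) ∈ A1 ↔ ∃ n, x ∈ step1Dom n true ∧ y = step1Fun n true x := by
  simp [A1_eq_unionGraphs, unionGraphs, graphRel]

theorem continuous_step1Fun (n : ℕ) (d : Bool) : Continuous (step1Fun n d) :=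
  continuous_id.update n continuous_const

theorem isClopen_step1Dom (n : ℕ) (d : Bool) : IsClopen (step1Dom n d) := by
  have h : step1Dom n d =
      (⋂ i ∈ Set.Iio n, (fun x : Cantor => x i) ⁻¹' {sSeqFn n i}) ∩
        (fun x : Cantor => x n) ⁻¹' {!d} := by
    ext x
    simp [step1Dom]
  rw [h]
  exact ((Set.finite_Iio n).isClopen_biInter fun i _ =>
    (isClopen_discrete _).preimage (continuous_apply i)).inter
      ((isClopen_discrete _).preimage (continuous_apply n))

theorem isClosed_graphRel_step1 (n : ℕ) (d : Bool) :
    IsClosed (graphRel (step1Dom n d) (step1Fun n d)) :=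
  ((isClopen_step1Dom n d).isClosed.preimage continuous_fst).inter
    (isClosed_eq continuous_snd ((continuous_step1Fun n d).comp continuous_fst))

theorem disjoint_A1_diagonal : Disjoint A1 (Set.diagonal Cantor) := by
  rw [Set.disjoint_left]
  rintro ⟨x, y⟩ hA (rfl : x = y)
  obtain ⟨n, hx, hy⟩ := mem_A1_iff.1 hA
  have := congrFun hy n
  simp [step1Fun, hx.2] at this

/-- Every neighbourhood of a point of `2^ω` contains arbitrarily late cones `N_{s_n}`. -/
theorem exists_forall_eq_sSeqFn_mem {x : Cantor} {U : Set Cantor} (hU : U ∈ 𝓝 x) :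
    ∃ n, ∀ y : Cantor, (∀ i < n, y i = sSeqFn n i) → y ∈ U := by
  rw [nhds_pi, Filter.mem_pi] at hU
  obtain ⟨I, hI, t, ht, htU⟩ := hU
  obtain ⟨N, hN⟩ := hI.bddAbove
  obtain ⟨n, hn, hs⟩ := exists_sSeqFn_eq x (N + 1)
  refine ⟨n, fun y hy => htU fun i hi => ?_⟩
  have hiN : i < N + 1 := Nat.lt_succ_of_le (hN hi)
  rw [hy i (hiN.trans_le hn), hs i hiN]
  exact mem_of_mem_nhds (ht i)

theorem diagonal_subset_closure_A1 : Set.diagonal Cantor ⊆ closure A1 := by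
  rintro ⟨x, y⟩ (rfl : x = y)
  rw [mem_closure_iff_nhds]
  intro W hW
  rw [nhds_prod_eq, Filter.mem_prod_same_iff] at hW
  obtain ⟨U, hU, hUW⟩ := hW
  obtain ⟨n, hn⟩ := exists_forall_eq_sSeqFn_mem hU
  let z : Cantor := fun i => if i < n then sSeqFn n i else false
  have hz : z ∈ step1Dom n true := ⟨fun i hi => by simp [z, hi], by simp [z]⟩
  refine ⟨(z, step1Fun n true z), hUW ⟨hn _ hz.1, hn _ fun i hi => ?_⟩, mem_A1_iff.2 ⟨n, hz, rfl⟩⟩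
  simp [step1Fun, hi.ne, hz.1 i hi]

theorem closure_A1_subset : closure A1 ⊆ A1 ∪ Set.diagonal Cantor := by
  rintro ⟨x, y⟩ hxy
  by_cases hne : x = y
  · exact Or.inr hne
  refine Or.inl ?_
  have hex : ∃ n, x n ≠ y n := Function.ne_iff.1 hne
  classical
  let n := Nat.find hex
  have hn : x n ≠ y n := Nat.find_spec hex
  have hlt : ∀ i < n, x i = y i := fun i hi => not_not.1 (Nat.find_min hex hi)
  let W : Set (Cantor × Cantor) :=
    ⋂ i ∈ Set.Iic n, (fun p : Cantor × Cantor => (p.1 i, p.2 i)) ⁻¹' {(x i, y i)}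
  have hW : IsOpen W := (Set.finite_Iic n).isOpen_biInter fun i _ =>
    (isOpen_discrete _).preimage (by fun_prop)
  have hmem : (x, y) ∈ W := by simp [W]
  have hsub : W ∩ A1 ⊆ graphRel (step1Dom n true) (step1Fun n true) := by
    rintro ⟨a, b⟩ ⟨hab, hA⟩
    simp only [W, mem_iInter, mem_Iic, mem_preimage, mem_singleton_iff, Prod.mk.injEq] at hab
    obtain ⟨m, ha, hb⟩ := mem_A1_iff.1 hA
    suffices m = n by subst this; exact ⟨ha, hb⟩
    rcases lt_trichotomy m n with h | h | h
    · have hm := hab m h.le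
      have hbm := congrFun hb m
      have ham := ha.2
      rw [hm.1] at ham
      rw [hm.2, ← hlt m h, ham] at hbm
      simp [step1Fun] at hbm
    · exact h
    · have hm := hab n le_rfl
      have hbn := congrFun hb n
      rw [step1Fun, Function.update_of_ne h.ne, hm.1, hm.2] at hbn
      exact absurd hbn.symm hn
  have := closure_minimal hsub (isClosed_graphRel_step1 n true) (hW.inter_closure ⟨hmem, hxy⟩)
  exact mem_A1_iff.2 ⟨n, this⟩

theorem closure_A1 : closure A1 = A1 ∪ Set.diagonal Cantor :=
  closure_A1_subset.antisymm (union_subset subset_closure diagonal_subset_closure_A1)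

/-- A finer Polish topology agrees with the original one on a comeager set. -/
theorem exists_mem_residual_nhds_of_le {X : Type*} {σ t : TopologicalSpace X} (hle : σ ≤ t)
    (hσ : @PolishSpace X σ) (ht : @PolishSpace X t) :
    ∃ G ∈ @residual X t, ∀ x ∈ G, ∀ U : Set X, IsOpen[σ] U → x ∈ U →
      ∃ V ∈ @nhds X t x, V ∩ G ⊆ U := by
  have hsc : @SecondCountableTopology X σ := hσ.toSecondCountableTopology
  let B := @TopologicalSpace.countableBasis X σ hsc
  have hB : @TopologicalSpace.IsTopologicalBasis X σ B :=
    @TopologicalSpace.isBasis_countableBasis X σ hsc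
  have hBc : B.Countable := @TopologicalSpace.countable_countableBasis X σ hsc
  have key : ∀ U ∈ B, ∃ V : Set X, IsOpen[t] V ∧ U =ᶠ[@residual X t] V := by
    intro U hU
    have hUo : IsOpen[σ] U := @TopologicalSpace.isOpen_of_mem_countableBasis X σ hsc U hU
    have hm : @MeasurableSet X (@borel X t) U := by
      rw [← MeasureTheory.borel_eq_borel_of_le hσ ht hle]
      exact MeasurableSpace.measurableSet_generateFrom hUo
    let _ := t
    let _ : MeasurableSpace X := borel X
    have : BorelSpace X := ⟨rfl⟩
    exact hm.residualEq_isOpen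
  choose! V hVo hV using key
  let _ := t
  refine ⟨{x | ∀ U ∈ B, x ∈ U ↔ x ∈ V U},
    (eventually_countable_ball hBc).2 fun U hU => Filter.eventuallyEq_set.1 (hV U hU), ?_⟩
  intro x hx U hUo hxU
  obtain ⟨U', hU', hxU', hsub⟩ :=
    @TopologicalSpace.IsTopologicalBasis.exists_subset_of_mem_open X σ B hB x U hxU hUo
  exact ⟨V U', (hVo U' hU').mem_nhds ((hx U' hU').1 hxU'),
    fun y hy => hsub ((hy.2 U' hU').2 hy.1)⟩

/-- The involution of `2^ω` flipping the `n`-th coordinate. -/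
def flipHomeo (n : ℕ) : Cantor ≃ₜ Cantor where
  toFun x := Function.update x n (!x n)
  invFun x := Function.update x n (!x n)
  left_inv x := by simp
  right_inv x := by simp
  continuous_toFun := continuous_id.update n <|
    (continuous_of_discreteTopology (f := not)).comp (continuous_apply n)
  continuous_invFun := continuous_id.update n <|
    (continuous_of_discreteTopology (f := not)).comp (continuous_apply n)

theorem flipHomeo_eq_step1Fun {n : ℕ} {x : Cantor} (hx : x ∈ step1Dom n true) :
    flipHomeo n x = step1Fun n true x := by
  change Function.update x n (!x n) = Function.update x n true
  rw [hx.2]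
  rfl

theorem step1Dom_nonempty (n : ℕ) (d : Bool) : (step1Dom n d).Nonempty :=
  ⟨fun i => if i < n then sSeqFn n i else !d, fun i hi => by simp [hi], by simp⟩

/-- Near each diagonal point, `A₁` meets every product of two comeager sets. -/
theorem exists_mem_A1_of_mem_residual {G H U W : Set Cantor} (hG : G ∈ residual Cantor)
    (hH : H ∈ residual Cantor) {x : Cantor} (hU : U ∈ 𝓝 x) (hW : W ∈ 𝓝 x) :
    ∃ p ∈ A1, p.1 ∈ U ∩ G ∧ p.2 ∈ W ∩ H := by
  obtain ⟨n, hn⟩ := exists_forall_eq_sSeqFn_mem (Filter.inter_mem hU hW)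
  have hflip : flipHomeo n ⁻¹' H ∈ residual Cantor :=
    tendsto_residual_of_isOpenMap (flipHomeo n).continuous (flipHomeo n).isOpenMap hH
  obtain ⟨z, hz, hzG, hzH⟩ := (dense_of_mem_residual (Filter.inter_mem hG hflip)).inter_open_nonempty
    _ (isClopen_step1Dom n true).isOpen (step1Dom_nonempty n true)
  rw [mem_preimage, flipHomeo_eq_step1Fun hz] at hzH
  refine ⟨(z, step1Fun n true z), mem_A1_iff.2 ⟨n, hz, rfl⟩,
    ⟨(hn z hz.1).1, hzG⟩, ⟨(hn _ fun i hi => ?_).2, hzH⟩⟩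
  simp [step1Fun, hi.ne, hz.1 i hi]

theorem not_potClosed_A1 : ¬ PotClosed inferInstance inferInstance A1 := by
  have hP : PolishSpace Cantor := by
    let _ := TopologicalSpace.metrizableSpaceMetric Cantor
    infer_instance
  have hne : ∀ G ∈ residual Cantor, G.Nonempty := fun G hG => (dense_of_mem_residual hG).nonempty
  rintro ⟨σ, τ, hσ, hτ, hσP, hτP, hcl⟩
  obtain ⟨G, hG, hGσ⟩ := exists_mem_residual_nhds_of_le hσ hσP hP
  obtain ⟨H, hH, hHτ⟩ := exists_mem_residual_nhds_of_le hτ hτP hP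
  obtain ⟨x, hxG, hxH⟩ := hne _ (Filter.inter_mem hG hH)
  obtain ⟨U, W, hU, hW, hxU, hxW, hUW⟩ :=
    (@isOpen_prod_iff Cantor Cantor σ τ _).1 hcl.isOpen_compl x x
      (Set.disjoint_right.1 disjoint_A1_diagonal rfl)
  obtain ⟨U', hU', hUG⟩ := hGσ x hxG U hU hxU
  obtain ⟨W', hW', hWH⟩ := hHτ x hxH W hW hxW
  obtain ⟨p, hpA, hpU, hpW⟩ := exists_mem_A1_of_mem_residual hG hH hU' hW'
  exact hUW ⟨hUG hpU, hWH hpW⟩ hpA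

theorem stmt5 :
    closure A1 = A1 ∪ Set.diagonal Cantor ∧
    A1 = closure A1 \ Set.diagonal Cantor ∧
    D2Sigma01 inferInstance A1 ∧
    ¬ PotClosed inferInstance inferInstance A1 := by
  have hdiff : A1 = closure A1 \ Set.diagonal Cantor := by
    rw [closure_A1, union_sdiff_right, disjoint_A1_diagonal.sdiff_eq_left]
  refine ⟨closure_A1, hdiff, ⟨(Set.diagonal Cantor)ᶜ, (closure A1)ᶜ,
    isClosed_diagonal.isOpen_compl, isClosed_closure.isOpen_compl, ?_⟩, not_potClosed_A1⟩
  rwa [sdiff_compl, inter_comm, ← sdiff_eq]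
end
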